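/- arXiv:1506.05918 — 7 statements merged into one kernel-verified Lean document; each statement's English description precedes it below -/
import Mathlib

section
/- For every α ∈ ℝ, the determinant of the 4×4 matrix E(α) equals −(1/9)·η1·η2·ℓ1³·ℓ2³·[ (1/4)(ξ1ℓ1+ξ2ℓ2)(η1ℓ1+η2ℓ2)cos²α + (ξ1ℓ1 + (1/4)η2ℓ2)((1/4)η1ℓ1 + ξ2ℓ2) sin²α ]. -/
open Real Matrix Set

/-- The 4×4 matrix E(α) of the two-link magneto-elastic swimmer,
with blocks E11, E12, E21, E22 as in the paper. -/
noncomputable def Emat (l1 l2 x1 x2 e1 e2 a : ℝ) : Matrix (Fin 4) (Fin 4) ℝ :=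
  !![ -(x1*l1 + x2*l2) * Real.cos a, -(x1*l1 + e2*l2) * Real.sin a,
        (1/2)*x1*l1*l2*Real.sin a, 0;
      (e1*l1 + x2*l2) * Real.sin a, -(e1*l1 + e2*l2) * Real.cos a,
        (1/2)*e1*l1*(l1 + l2*Real.cos a), (1/2)*e1*l1^2;
      (1/2)*(e1*l1^2*(-Real.sin a)), (1/2)*(e1*l1^2*Real.cos a - e2*l2^2),
        -(e1*l1^2*((1/4)*l2*Real.cos a + (1/3)*l1) + e2*l2^2*((1/12)*l2)),
        -(e1*l1^2*((1/3)*l1));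
      0, (1/2)*(-(e2*l2^2)), -(e2*l2^2*((1/12)*l2)), 0]

/-- R̃(θ) = diag(R_θ, I₂). -/
noncomputable def Rtil (th : ℝ) : Matrix (Fin 4) (Fin 4) ℝ :=
  !![Real.cos th, -Real.sin th, 0, 0;
     Real.sin th,  Real.cos th, 0, 0;
     0, 0, 1, 0;
     0, 0, 0, 1]

/-- X3(z) = R̃(θ)·(third column of E(α)⁻¹), where z = (x,y,θ,α). -/
noncomputable def X3 (l1 l2 x1 x2 e1 e2 : ℝ) (z : Fin 4 → ℝ) : Fin 4 → ℝ :=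
  (Rtil (z 2)).mulVec fun i => (Emat l1 l2 x1 x2 e1 e2 (z 3))⁻¹ i 2

/-- X4(z) = R̃(θ)·(fourth column of E(α)⁻¹), where z = (x,y,θ,α). -/
noncomputable def X4 (l1 l2 x1 x2 e1 e2 : ℝ) (z : Fin 4 → ℝ) : Fin 4 → ℝ :=
  (Rtil (z 2)).mulVec fun i => (Emat l1 l2 x1 x2 e1 e2 (z 3))⁻¹ i 3

/-- F0(z) = κ α X4(z). -/
noncomputable def F0 (l1 l2 x1 x2 e1 e2 k : ℝ) (z : Fin 4 → ℝ) : Fin 4 → ℝ :=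
  (k * z 3) • X4 l1 l2 x1 x2 e1 e2 z

/-- F1(z) = M1 sin α · X3(z). -/
noncomputable def F1 (l1 l2 x1 x2 e1 e2 M1 : ℝ) (z : Fin 4 → ℝ) : Fin 4 → ℝ :=
  (M1 * Real.sin (z 3)) • X3 l1 l2 x1 x2 e1 e2 z

/-- F2(z) = −(M1 cos α + M2) X3(z) − M2 X4(z). -/
noncomputable def F2 (l1 l2 x1 x2 e1 e2 M1 M2 : ℝ) (z : Fin 4 → ℝ) : Fin 4 → ℝ :=
  (-(M1 * Real.cos (z 3) + M2)) • X3 l1 l2 x1 x2 e1 e2 z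
    - M2 • X4 l1 l2 x1 x2 e1 e2 z

/-- Lie bracket of two vector fields on ℝ⁴: [X,Y](z) = DY(z)·X(z) − DX(z)·Y(z). -/
noncomputable def lieBr (X Y : (Fin 4 → ℝ) → (Fin 4 → ℝ)) (z : Fin 4 → ℝ) : Fin 4 → ℝ :=
  fderiv ℝ Y z (X z) - fderiv ℝ X z (Y z)

/-- The origin O = (0,0,0,0). -/
def Ovec : Fin 4 → ℝ := ![0, 0, 0, 0]

/-- Assumption A of the paper. -/
def AssumptionA (l1 l2 x1 x2 e1 e2 M1 M2 : ℝ) : Prop :=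
  ((e1 - x1, e2 - x2) ≠ (0, 0)) ∧ x1 ≤ e1 ∧ x2 ≤ e2 ∧ M1 ≠ 0 ∧ M2 ≠ 0 ∧
    (3 + 4*(l2/l1) + e2*l2^2/(e1*l1^2)) * M1
      - (3 + 4*(l1/l2) + e1*l1^2/(e2*l2^2)) * M2 ≠ 0

/-- explicit formula for det E(α). -/
theorem stmt_0 (l1 l2 x1 x2 e1 e2 k M1 M2 : ℝ)
    (hl1 : 0 < l1) (hl2 : 0 < l2) (hx1 : 0 < x1) (hx2 : 0 < x2)
    (he1 : 0 < e1) (he2 : 0 < e2) (hk : 0 < k) :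
    ∀ a : ℝ,
      (Emat l1 l2 x1 x2 e1 e2 a).det =
        -(1/9) * e1 * e2 * l1^3 * l2^3 *
          ((1/4) * (x1*l1 + x2*l2) * (e1*l1 + e2*l2) * Real.cos a ^ 2
            + (x1*l1 + (1/4)*e2*l2) * ((1/4)*e1*l1 + x2*l2) * Real.sin a ^ 2) := by
  intro a
  rw [Emat, det_succ_row_zero]
  simp only [Fin.sum_univ_succ, det_fin_three, submatrix_apply]
  simp [Fin.succAbove]
  ring
end

section
/- For every α ∈ ℝ, det E(α) < 0; in particular the matrix E(α) is invertible for every α ∈ ℝ. -/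
open Real Matrix Set

/-- Closed form of det E(α). -/
theorem Emat_det (l1 l2 x1 x2 e1 e2 a : ℝ) :
    (Emat l1 l2 x1 x2 e1 e2 a).det =
      -(e1 * l1 ^ 3 * e2 * l2 ^ 3 / 36 *
        ((x1 * l1 + x2 * l2) * (e1 * l1 + e2 * l2) * Real.cos a ^ 2 +
          (4 * (x1 * l1) + e2 * l2) * (e1 * l1 / 4 + x2 * l2) * Real.sin a ^ 2)) := by
  simp [Emat, Matrix.det_succ_row_zero, Fin.sum_univ_succ, Fin.succAbove]
  ring

/-- det E(α) < 0, hence E(α) is invertible, for every α. -/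
theorem stmt_1 (l1 l2 x1 x2 e1 e2 k M1 M2 : ℝ)
    (hl1 : 0 < l1) (hl2 : 0 < l2) (hx1 : 0 < x1) (hx2 : 0 < x2)
    (he1 : 0 < e1) (he2 : 0 < e2) (hk : 0 < k) :
    ∀ a : ℝ, (Emat l1 l2 x1 x2 e1 e2 a).det < 0 ∧ IsUnit (Emat l1 l2 x1 x2 e1 e2 a) := by
  intro a
  have hdet : (Emat l1 l2 x1 x2 e1 e2 a).det < 0 := by
    rw [Emat_det, neg_lt_zero]
    apply mul_pos (by positivity)
    rcases eq_or_ne (Real.sin a) 0 with hs | hs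
    · have hc : Real.cos a ^ 2 = 1 := by rw [Real.cos_sq', hs]; norm_num
      rw [hs, hc]
      positivity
    · positivity
  exact ⟨hdet, (Matrix.isUnit_iff_isUnit_det _).2 hdet.ne.isUnit⟩
end

section
/- For every z = (x, y, θ, 0) ∈ ℝ⁴ (i.e. with α = 0) and every H∥, H⊥ ∈ ℝ, the fourth component of the vector F0(z) + H∥ F1(z) + H⊥ F2(z) equals 3·[ (3 + 4ℓ2/ℓ1 + η2ℓ2²/(η1ℓ1²)) M1 − (3 + 4ℓ1/ℓ2 + η1ℓ1²/(η2ℓ2²)) M2 ] · H⊥ / (ℓ1 ℓ2 (η1ℓ1 + η2ℓ2)). -/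
open Real Matrix Set

/-- A vector `w` with `w A = eᵢ` is the `i`-th row of `A⁻¹`. -/
theorem Matrix.inv_apply_of_vecMul_eq_single {n R : Type*} [Fintype n] [DecidableEq n] [CommRing R]
    {A : Matrix n n R} (hA : IsUnit A.det) {w : n → R} {i : n}
    (hw : w ᵥ* A = Pi.single i 1) (j : n) : A⁻¹ i j = w j := by
  have h : w = Pi.single i 1 ᵥ* A⁻¹ := by
    rw [← hw, Matrix.vecMul_vecMul, Matrix.mul_nonsing_inv A hA, Matrix.vecMul_one]
  rw [h, Matrix.single_one_vecMul, Matrix.row_apply]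

theorem det_Emat_zero (l1 l2 x1 x2 e1 e2 : ℝ) :
    (Emat l1 l2 x1 x2 e1 e2 0).det =
      -(x1*l1 + x2*l2) * (e1*l1^2 * (e2*l2^2) * (e1*l1 + e2*l2) * l1 * l2 / 36) := by
  simp [Emat, Matrix.det_succ_row_zero, Fin.sum_univ_succ, Fin.succAbove,
    -mul_eq_mul_left_iff]
  ring

theorem vecMul_Emat_zero (l1 l2 x1 x2 e1 e2 : ℝ)
    (hl1 : l1 ≠ 0) (hl2 : l2 ≠ 0) (he1 : e1 ≠ 0) (he2 : e2 ≠ 0) (hS : e1*l1 + e2*l2 ≠ 0) :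
    ![0, -6*(l1 + l2) / (l1*l2*(e1*l1 + e2*l2)),
      -3*(3 + 4*(l2/l1) + e2*l2^2/(e1*l1^2)) / (l1*l2*(e1*l1 + e2*l2)),
      3*((3 + 4*(l1/l2) + e1*l1^2/(e2*l2^2)) + (3 + 4*(l2/l1) + e2*l2^2/(e1*l1^2)))
        / (l1*l2*(e1*l1 + e2*l2))] ᵥ* Emat l1 l2 x1 x2 e1 e2 0 = Pi.single 3 1 := by
  have hS' : l1*e1 + l2*e2 ≠ 0 := by rwa [mul_comm l1, mul_comm l2]
  ext j
  fin_cases j <;> simp [Emat, Matrix.vecMul, dotProduct, Fin.sum_univ_succ] <;>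
    field_simp <;> ring

/-- explicit formula for the fourth component (α̇) of the dynamics at α = 0. -/
theorem stmt_5 (l1 l2 x1 x2 e1 e2 k M1 M2 : ℝ)
    (hl1 : 0 < l1) (hl2 : 0 < l2) (hx1 : 0 < x1) (hx2 : 0 < x2)
    (he1 : 0 < e1) (he2 : 0 < e2) (hk : 0 < k) :
    ∀ (x y th Hpar Hperp : ℝ),
      (F0 l1 l2 x1 x2 e1 e2 k ![x, y, th, 0]
        + Hpar • F1 l1 l2 x1 x2 e1 e2 M1 ![x, y, th, 0]
        + Hperp • F2 l1 l2 x1 x2 e1 e2 M1 M2 ![x, y, th, 0]) 3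
      = 3 * ((3 + 4*(l2/l1) + e2*l2^2/(e1*l1^2)) * M1
              - (3 + 4*(l1/l2) + e1*l1^2/(e2*l2^2)) * M2) * Hperp
          / (l1 * l2 * (e1*l1 + e2*l2)) := by
  intro x y th Hpar Hperp
  have hS : e1*l1 + e2*l2 ≠ 0 := by positivity
  have hdet : IsUnit (Emat l1 l2 x1 x2 e1 e2 0).det := by
    have hX : -(x1*l1 + x2*l2) ≠ 0 := neg_ne_zero.mpr (by positivity)
    rw [isUnit_iff_ne_zero, det_Emat_zero]
    exact mul_ne_zero hX (by positivity)
  have hrow := Matrix.inv_apply_of_vecMul_eq_single hdet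
    (vecMul_Emat_zero l1 l2 x1 x2 e1 e2 hl1.ne' hl2.ne' he1.ne' he2.ne' hS)
  simp [F0, F1, F2, X3, X4, Rtil, dotProduct, Fin.sum_univ_succ]
  rw [hrow, hrow]
  simp
  ring
end

section
/- (Local controllability.) Let Assumption A hold and fix an equilibrium z^e = (x^e, y^e, θ^e, 0) ∈ ℝ⁴. For every neighborhood W of z^e in ℝ⁴ and all real numbers T > 0 and ε > 0, there exists a neighborhood V ⊆ W of z^e such that: for all z^i, z^f ∈ V there exist bounded measurable functions H∥, H⊥ : [0,T] → ℝ with ‖H⊥‖∞ < ε and ‖H∥‖∞ < 2κ|M1+M2|/|M1·M2| + ε, and an absolutely continuous function z : [0,T] → ℝ⁴ satisfying ż(t) = F0(z(t)) + H∥(t) F1(z(t)) + H⊥(t) F2(z(t)) for almost every t ∈ [0,T], with z(0) = z^i, z(T) = z^f, and z(t) ∈ W for all t ∈ [0,T]. -/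
open Real Matrix Set

/-- `Steer f W B₁ B₂ τ p q`: bounded measurable controls `u`, `w`, with `|u| < B₁` and `|w| < B₂`,
drive the system `ż = f z u w` from `p` to `q` in time `τ` along a trajectory inside `W`. -/
def Steer {E : Type*} [NormedAddCommGroup E] [NormedSpace ℝ E] (f : E → ℝ → ℝ → E) (W : Set E)
    (B₁ B₂ τ : ℝ) (p q : E) : Prop :=
  ∃ (u w : ℝ → ℝ) (z : ℝ → E), Measurable u ∧ Measurable w ∧ z 0 = p ∧ z τ = q ∧
    ContinuousOn z (Icc 0 τ) ∧ (∀ t ∈ Icc 0 τ, |u t| < B₁ ∧ |w t| < B₂ ∧ z t ∈ W) ∧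
    ∃ S : Set ℝ, S.Countable ∧ ∃ C : ℝ, ∀ t ∈ Ioo 0 τ \ S,
      HasDerivAt z (f (z t) (u t) (w t)) t ∧ ‖f (z t) (u t) (w t)‖ ≤ C

section Steer

variable {E : Type*} [NormedAddCommGroup E] [NormedSpace ℝ E] {f : E → ℝ → ℝ → E} {W : Set E}
  {B₁ B₂ : ℝ}

lemma Steer.of_hasDerivAt {τ : ℝ} (u w : ℝ → ℝ) (hu : Measurable u) (hw : Measurable w)
    (z z' : ℝ → E) (hz : ∀ t, HasDerivAt z (z' t) t) (hz' : Continuous z')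
    (h : ∀ t ∈ Icc 0 τ, |u t| < B₁ ∧ |w t| < B₂ ∧ z t ∈ W)
    (hf : ∀ t ∈ Icc 0 τ, f (z t) (u t) (w t) = z' t) :
    Steer f W B₁ B₂ τ (z 0) (z τ) := by
  obtain ⟨C, hC⟩ := (isCompact_Icc (a := (0 : ℝ)) (b := τ)).exists_bound_of_continuousOn
    hz'.continuousOn
  refine ⟨u, w, z, hu, hw, rfl, rfl, fun t _ => (hz t).continuousAt.continuousWithinAt, h,
    ∅, countable_empty, C, fun t ht => ?_⟩
  rw [hf t (Ioo_subset_Icc_self ht.1)]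
  exact ⟨hz t, hC t (Ioo_subset_Icc_self ht.1)⟩

lemma Steer.trans {τ₁ τ₂ : ℝ} (h₁ : 0 ≤ τ₁) (h₂ : 0 ≤ τ₂) {p q r : E}
    (hpq : Steer f W B₁ B₂ τ₁ p q) (hqr : Steer f W B₁ B₂ τ₂ q r) :
    Steer f W B₁ B₂ (τ₁ + τ₂) p r := by
  obtain ⟨u₁, w₁, z₁, hu₁, hw₁, hp₁, hq₁, hc₁, hb₁, S₁, hS₁, C₁, hd₁⟩ := hpq
  obtain ⟨u₂, w₂, z₂, hu₂, hw₂, hp₂, hq₂, hc₂, hb₂, S₂, hS₂, C₂, hd₂⟩ := hqr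
  have hcomp : ∀ {g : ℝ → ℝ}, Measurable g → Measurable fun t => g (t - τ₁) := fun hg =>
    hg.comp (measurable_id.sub_const _)
  refine ⟨fun t => if t ≤ τ₁ then u₁ t else u₂ (t - τ₁),
    fun t => if t ≤ τ₁ then w₁ t else w₂ (t - τ₁),
    fun t => if t ≤ τ₁ then z₁ t else z₂ (t - τ₁),
    Measurable.ite measurableSet_Iic hu₁ (hcomp hu₂),
    Measurable.ite measurableSet_Iic hw₁ (hcomp hw₂), ?_, ?_, ?_, ?_,
    S₁ ∪ {τ₁} ∪ (fun t => t + τ₁) '' S₂, (hS₁.union (countable_singleton _)).union (hS₂.image _),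
    max C₁ C₂, ?_⟩
  · simp [h₁, hp₁]
  · rcases h₂.eq_or_lt with rfl | h₂
    · simp [hq₁, ← hq₂, hp₂]
    · simp [h₂, hq₂]
  · have hc₂' : ContinuousOn (fun t => z₂ (t - τ₁)) (Icc τ₁ (τ₁ + τ₂)) :=
      hc₂.comp (by fun_prop) fun t ht => ⟨by linarith [ht.1], by linarith [ht.2]⟩
    have hA : ContinuousOn (fun t => if t ≤ τ₁ then z₁ t else z₂ (t - τ₁)) (Icc 0 τ₁) :=
      hc₁.congr fun t ht => by simp [ht.2]
    have hB : ContinuousOn (fun t => if t ≤ τ₁ then z₁ t else z₂ (t - τ₁))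
        (Icc τ₁ (τ₁ + τ₂)) := by
      refine hc₂'.congr fun t ht => ?_
      rcases ht.1.eq_or_lt with rfl | h
      · simp [hq₁, hp₂]
      · simp [not_le.2 h]
    rw [← Icc_union_Icc_eq_Icc h₁ (by linarith : τ₁ ≤ τ₁ + τ₂)]
    exact hA.union_of_isClosed hB isClosed_Icc isClosed_Icc
  · intro t ht
    by_cases h : t ≤ τ₁
    · simpa [h] using hb₁ t ⟨ht.1, h⟩
    · simpa [h] using hb₂ (t - τ₁) ⟨by linarith, by linarith [ht.2]⟩
  · rintro t ⟨ht, htS⟩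
    simp only [mem_union, mem_singleton_iff, mem_image, not_or, not_exists, not_and] at htS
    obtain ⟨⟨ht₁, htτ⟩, ht₂⟩ := htS
    rcases lt_or_gt_of_ne htτ with h | h
    · obtain ⟨hd, hC⟩ := hd₁ t ⟨⟨ht.1, h⟩, ht₁⟩
      simp only [h.le, if_true]
      refine ⟨hd.congr_of_eventuallyEq ?_, hC.trans (le_max_left _ _)⟩
      filter_upwards [Iio_mem_nhds h] with s hs
      simp [le_of_lt (mem_Iio.1 hs)]
    · obtain ⟨hd, hC⟩ := hd₂ (t - τ₁) ⟨⟨by linarith, by linarith [ht.2]⟩,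
        fun hs => ht₂ _ hs (by ring)⟩
      simp only [not_le.2 h, if_false]
      refine ⟨(hd.comp_sub_const t τ₁).congr_of_eventuallyEq ?_, hC.trans (le_max_right _ _)⟩
      filter_upwards [Ioi_mem_nhds h] with s hs
      simp [not_le.2 (mem_Ioi.1 hs)]

lemma Steer.exists_integral_eq [CompleteSpace E] {τ : ℝ} {p q : E} (h : Steer f W B₁ B₂ τ p q) :
    ∃ u w : ℝ → ℝ, Measurable u ∧ Measurable w ∧ (∀ t ∈ Icc 0 τ, |w t| < B₂) ∧
      (∀ t ∈ Icc 0 τ, |u t| < B₁) ∧ ∃ z : ℝ → E, ContinuousOn z (Icc 0 τ) ∧ z 0 = p ∧ z τ = q ∧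
        (∀ t ∈ Icc 0 τ, z t ∈ W) ∧
        ∀ t ∈ Icc 0 τ, z t = p + ∫ s in (0 : ℝ)..t, f (z s) (u s) (w s) := by
  obtain ⟨u, w, z, hu, hw, hp, hq, hc, hb, S, hS, C, hd⟩ := h
  refine ⟨u, w, hu, hw, fun t ht => (hb t ht).2.1, fun t ht => (hb t ht).1, z, hc, hp, hq,
    fun t ht => (hb t ht).2.2, fun t ht => ?_⟩
  have hsub : Ioo 0 t \ S ⊆ Ioo 0 τ \ S := sdiff_subset_sdiff_left (Ioo_subset_Ioo_right ht.2)
  have hae : ∀ᵐ s ∂MeasureTheory.volume.restrict (Ioo 0 t), s ∈ Ioo 0 t \ S := by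
    rw [MeasureTheory.ae_restrict_iff' measurableSet_Ioo]
    filter_upwards [hS.ae_notMem MeasureTheory.volume] with s hs hs' using ⟨hs', hs⟩
  have hint : IntervalIntegrable (fun s => f (z s) (u s) (w s)) MeasureTheory.volume 0 t := by
    rw [intervalIntegrable_iff_integrableOn_Ioo_of_le ht.1]
    refine MeasureTheory.Integrable.mono' (g := fun _ => C)
      (MeasureTheory.integrableOn_const (by simp)) ?_ ?_
    · refine (aestronglyMeasurable_deriv z _).congr ?_
      filter_upwards [hae] with s hs using (hd s (hsub hs)).1.deriv
    · filter_upwards [hae] with s hs using (hd s (hsub hs)).2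
  rw [MeasureTheory.integral_eq_of_hasDerivAt_off_countable_of_le z _ ht.1 hS
    (hc.mono (Icc_subset_Icc_right ht.2)) (fun s hs => (hd s (hsub hs)).1) hint, hp]
  abel

end Steer

lemma Rtil_mulVec (th a b c d : ℝ) :
    (Rtil th).mulVec ![a, b, c, d] = ![cos th * a - sin th * b, sin th * a + cos th * b, c, d] := by
  ext i
  fin_cases i <;> simp [Rtil, Matrix.mulVec, dotProduct, Fin.sum_univ_four, sub_eq_add_neg]

lemma hasDerivAt_vec4 {a b c d : ℝ → ℝ} {a' b' c' d' t : ℝ} (ha : HasDerivAt a a' t)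
    (hb : HasDerivAt b b' t) (hc : HasDerivAt c c' t) (hd : HasDerivAt d d' t) :
    HasDerivAt (fun t => ![a t, b t, c t, d t]) ![a', b', c', d'] t := by
  rw [hasDerivAt_pi]
  intro i
  fin_cases i <;> simpa

lemma continuous_vec4 {X : Type*} [TopologicalSpace X] {a b c d : X → ℝ} (ha : Continuous a)
    (hb : Continuous b) (hc : Continuous c) (hd : Continuous d) :
    Continuous fun t => ![a t, b t, c t, d t] := by
  refine continuous_pi fun i => ?_
  fin_cases i <;> simpa

/-- The configuration with shape `α` reached, by a motion whose shape-dependent displacement is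
the translation `(P₁, P₂)` and the rotation `Θ`, from the placement `(x, y, φ)` at shape zero. -/
noncomputable def placed (P₁ P₂ Θ : ℝ → ℝ) (x y φ α : ℝ) : Fin 4 → ℝ :=
  ![x + (cos φ * P₁ α - sin φ * P₂ α), y + (sin φ * P₁ α + cos φ * P₂ α), φ + Θ α, α]

/-- First coordinate of the rotation centre, in the frame of the placement, of the infinitesimal
rotation with body velocity `(b₁, b₂, 1, 0)`. -/
noncomputable def centre₁ (P₁ Θ b₁ b₂ : ℝ → ℝ) (α : ℝ) : ℝ :=
  P₁ α - cos (Θ α) * b₂ α - sin (Θ α) * b₁ α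

/-- Second coordinate of the rotation centre, in the frame of the placement, of the infinitesimal
rotation with body velocity `(b₁, b₂, 1, 0)`. -/
noncomputable def centre₂ (P₂ Θ b₁ b₂ : ℝ → ℝ) (α : ℝ) : ℝ :=
  P₂ α - sin (Θ α) * b₂ α + cos (Θ α) * b₁ α

section Placed

variable {f : (Fin 4 → ℝ) → ℝ → ℝ → Fin 4 → ℝ} {W : Set (Fin 4 → ℝ)} {B₁ B₂ : ℝ}
  {P₁ P₂ Θ a₁ a₂ r b₁ b₂ : ℝ → ℝ}

lemma continuous_placed (hP₁ : Continuous P₁) (hP₂ : Continuous P₂) (hΘ : Continuous Θ) :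
    Continuous fun v : ℝ × ℝ × ℝ × ℝ => placed P₁ P₂ Θ v.1 v.2.1 v.2.2.1 v.2.2.2 := by
  unfold placed
  apply continuous_vec4 <;> fun_prop

lemma placed_coords (z : Fin 4 → ℝ) :
    placed P₁ P₂ Θ (z 0 - (cos (z 2 - Θ (z 3)) * P₁ (z 3) - sin (z 2 - Θ (z 3)) * P₂ (z 3)))
      (z 1 - (sin (z 2 - Θ (z 3)) * P₁ (z 3) + cos (z 2 - Θ (z 3)) * P₂ (z 3)))
      (z 2 - Θ (z 3)) (z 3) = z := by
  ext i
  fin_cases i <;> simp [placed]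

/-- Changing the shape at constant rate while keeping the placement fixed. -/
lemma steer_shape (hΘ : ∀ a, HasDerivAt Θ (r a) a)
    (hP₁ : ∀ a, HasDerivAt P₁ (cos (Θ a) * a₁ a - sin (Θ a) * a₂ a) a)
    (hP₂ : ∀ a, HasDerivAt P₂ (sin (Θ a) * a₁ a + cos (Θ a) * a₂ a) a)
    (ha₁ : Continuous a₁) (ha₂ : Continuous a₂) (hr : Continuous r) {ρ τ : ℝ} (hτ : 0 < τ)
    (hctrl : ∀ s, |s| * τ ≤ 2 * ρ → ∃ u w : ℝ → ℝ, Measurable u ∧ Measurable w ∧ ∀ α, |α| < ρ →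
      |u α| < B₁ ∧ |w α| < B₂ ∧ ∀ z : Fin 4 → ℝ, z 3 = α →
        f z (u α) (w α) = s • (Rtil (z 2)).mulVec ![a₁ α, a₂ α, r α, 1])
    {x y φ : ℝ} (hW : ∀ α, |α| < ρ → placed P₁ P₂ Θ x y φ α ∈ W) {α β : ℝ} (hα : |α| < ρ)
    (hβ : |β| < ρ) :
    Steer f W B₁ B₂ τ (placed P₁ P₂ Θ x y φ α) (placed P₁ P₂ Θ x y φ β) := by
  obtain ⟨s, hs⟩ : ∃ s, s = (β - α) / τ := ⟨_, rfl⟩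
  have hsτ : s * τ = β - α := by rw [hs]; field_simp
  obtain ⟨u, w, hu, hw, huw⟩ := hctrl s (by
    rw [← abs_of_pos hτ, ← abs_mul, hsτ]
    rw [abs_lt] at hα hβ
    exact abs_le.2 ⟨by linarith, by linarith⟩)
  have hin : ∀ t ∈ Icc 0 τ, |α + s * t| < ρ := by
    intro t ht
    have h : α + s * t = (1 - t / τ) * α + t / τ * β := by rw [hs]; field_simp; ring
    have h0 : 0 ≤ t / τ := div_nonneg ht.1 hτ.le
    have h1 : t / τ ≤ 1 := (div_le_one hτ).2 ht.2
    rw [h]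
    calc |(1 - t / τ) * α + t / τ * β| ≤ (1 - t / τ) * |α| + t / τ * |β| := by
          refine (abs_add_le _ _).trans ?_
          rw [abs_mul, abs_mul, abs_of_nonneg h0, abs_of_nonneg (sub_nonneg.2 h1)]
      _ < ρ := by
          rcases h0.eq_or_lt with h0 | h0
          · rw [← h0]; simpa using hα
          · nlinarith
  have key := Steer.of_hasDerivAt (f := f) (W := W) (B₁ := B₁) (B₂ := B₂) (τ := τ)
    (fun t => u (α + s * t)) (fun t => w (α + s * t)) (hu.comp (by fun_prop))
    (hw.comp (by fun_prop)) (fun t => placed P₁ P₂ Θ x y φ (α + s * t))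
    (fun t => s • (Rtil (φ + Θ (α + s * t))).mulVec
      ![a₁ (α + s * t), a₂ (α + s * t), r (α + s * t), 1]) ?_ ?_ ?_ ?_
  · convert key using 2
    · ring
    · linarith [hsτ]
  · intro t
    have hl : HasDerivAt (fun t => α + s * t) s t := by
      simpa using ((hasDerivAt_id t).const_mul s).const_add α
    have h₁ := (hP₁ (α + s * t)).comp t hl
    have h₂ := (hP₂ (α + s * t)).comp t hl
    have h₃ := (hΘ (α + s * t)).comp t hl
    refine (hasDerivAt_vec4 (((h₁.const_mul (cos φ)).sub (h₂.const_mul (sin φ))).const_add x)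
      (((h₁.const_mul (sin φ)).add (h₂.const_mul (cos φ))).const_add y) (h₃.const_add φ)
      hl).congr_deriv ?_
    rw [Rtil_mulVec]
    ext i
    fin_cases i <;> simp [cos_add, sin_add] <;> ring
  · have hc : Continuous Θ := continuous_iff_continuousAt.2 fun a => (hΘ a).continuousAt
    simp only [Rtil_mulVec]
    refine Continuous.const_smul (continuous_vec4 ?_ ?_ ?_ ?_) s <;> fun_prop
  · intro t ht
    exact ⟨(huw _ (hin t ht)).1, (huw _ (hin t ht)).2.1, hW _ (hin t ht)⟩
  · intro t ht
    rw [(huw _ (hin t ht)).2.2 (placed P₁ P₂ Θ x y φ (α + s * t)) rfl]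
    rfl

/-- Rotating at constant rate while keeping the shape fixed. -/
lemma steer_rotate {τ : ℝ} (hτ : 0 < τ) {α σ : ℝ}
    (hctrl : ∀ s, |s| * τ < σ → ∃ u w : ℝ, |u| < B₁ ∧ |w| < B₂ ∧ ∀ z : Fin 4 → ℝ, z 3 = α →
        f z u w = s • (Rtil (z 2)).mulVec ![b₁ α, b₂ α, 1, 0])
    {x y φ ψ : ℝ} (hφψ : |ψ - φ| < σ)
    (hW : ∀ ω ∈ uIcc φ ψ, placed P₁ P₂ Θ
      (x + (cos φ * centre₁ P₁ Θ b₁ b₂ α - sin φ * centre₂ P₂ Θ b₁ b₂ α)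
        - (cos ω * centre₁ P₁ Θ b₁ b₂ α - sin ω * centre₂ P₂ Θ b₁ b₂ α))
      (y + (sin φ * centre₁ P₁ Θ b₁ b₂ α + cos φ * centre₂ P₂ Θ b₁ b₂ α)
        - (sin ω * centre₁ P₁ Θ b₁ b₂ α + cos ω * centre₂ P₂ Θ b₁ b₂ α)) ω α ∈ W) :
    Steer f W B₁ B₂ τ (placed P₁ P₂ Θ x y φ α) (placed P₁ P₂ Θ
      (x + (cos φ * centre₁ P₁ Θ b₁ b₂ α - sin φ * centre₂ P₂ Θ b₁ b₂ α)
        - (cos ψ * centre₁ P₁ Θ b₁ b₂ α - sin ψ * centre₂ P₂ Θ b₁ b₂ α))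
      (y + (sin φ * centre₁ P₁ Θ b₁ b₂ α + cos φ * centre₂ P₂ Θ b₁ b₂ α)
        - (sin ψ * centre₁ P₁ Θ b₁ b₂ α + cos ψ * centre₂ P₂ Θ b₁ b₂ α)) ψ α) := by
  obtain ⟨s, hs⟩ : ∃ s, s = (ψ - φ) / τ := ⟨_, rfl⟩
  have hsτ : s * τ = ψ - φ := by rw [hs]; field_simp
  obtain ⟨u, w, hu, hw, huw⟩ := hctrl s (by rwa [← abs_of_pos hτ, ← abs_mul, hsτ])
  have hin : ∀ t ∈ Icc 0 τ, φ + s * t ∈ uIcc φ ψ := by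
    intro t ht
    have h0 : 0 ≤ t / τ := div_nonneg ht.1 hτ.le
    have h1 : t / τ ≤ 1 := (div_le_one hτ).2 ht.2
    rw [← segment_eq_uIcc]
    exact ⟨1 - t / τ, t / τ, sub_nonneg.2 h1, h0, by ring, by
      rw [hs]; simp only [smul_eq_mul]; field_simp; ring⟩
  have key := Steer.of_hasDerivAt (f := f) (W := W) (B₁ := B₁) (B₂ := B₂) (τ := τ)
    (fun _ => u) (fun _ => w) measurable_const measurable_const
    (fun t => placed P₁ P₂ Θ
      (x + (cos φ * centre₁ P₁ Θ b₁ b₂ α - sin φ * centre₂ P₂ Θ b₁ b₂ α)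
        - (cos (φ + s * t) * centre₁ P₁ Θ b₁ b₂ α - sin (φ + s * t) * centre₂ P₂ Θ b₁ b₂ α))
      (y + (sin φ * centre₁ P₁ Θ b₁ b₂ α + cos φ * centre₂ P₂ Θ b₁ b₂ α)
        - (sin (φ + s * t) * centre₁ P₁ Θ b₁ b₂ α + cos (φ + s * t) * centre₂ P₂ Θ b₁ b₂ α))
      (φ + s * t) α)
    (fun t => s • (Rtil (φ + s * t + Θ α)).mulVec ![b₁ α, b₂ α, 1, 0]) ?_ ?_ ?_ ?_
  · convert key using 2
    · simp
    · simp
    · simp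
    · rw [hsτ]; ring_nf
    · rw [hsτ]; ring_nf
    · linarith [hsτ]
  · intro t
    have hl : HasDerivAt (fun t => φ + s * t) s t := by
      simpa using ((hasDerivAt_id t).const_mul s).const_add φ
    have hc := hl.cos
    have hn := hl.sin
    refine (hasDerivAt_vec4
      ((((hc.mul_const (centre₁ P₁ Θ b₁ b₂ α)).sub
        (hn.mul_const (centre₂ P₂ Θ b₁ b₂ α))).const_sub
        (x + (cos φ * centre₁ P₁ Θ b₁ b₂ α - sin φ * centre₂ P₂ Θ b₁ b₂ α))).add
        ((hc.mul_const (P₁ α)).sub (hn.mul_const (P₂ α))))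
      ((((hn.mul_const (centre₁ P₁ Θ b₁ b₂ α)).add
        (hc.mul_const (centre₂ P₂ Θ b₁ b₂ α))).const_sub
        (y + (sin φ * centre₁ P₁ Θ b₁ b₂ α + cos φ * centre₂ P₂ Θ b₁ b₂ α))).add
        ((hn.mul_const (P₁ α)).add (hc.mul_const (P₂ α))))
      (hl.add_const (Θ α)) (hasDerivAt_const t α)).congr_deriv ?_
    rw [Rtil_mulVec]
    ext i
    fin_cases i <;> simp [cos_add, sin_add, centre₁, centre₂] <;> ring
  · simp only [Rtil_mulVec]
    refine Continuous.const_smul (continuous_vec4 ?_ ?_ ?_ ?_) s <;> fun_prop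
  · exact fun t ht => ⟨hu, hw, hW _ (hin t ht)⟩
  · intro t ht
    rw [huw _ rfl]
    rfl

end Placed

open Filter Topology in
/-- A planar two-link arm whose links are not parallel can reach every point near its tip by small
changes of its two angles. -/
lemma map_twoLink_nhds {u₁ u₂ w₁ w₂ : ℝ} (h : u₁ * w₂ - u₂ * w₁ ≠ 0) (φ : ℝ) :
    map (fun p : ℝ × ℝ => (cos p.1 * u₁ - sin p.1 * u₂ + (cos p.2 * w₁ - sin p.2 * w₂),
      sin p.1 * u₁ + cos p.1 * u₂ + (sin p.2 * w₁ + cos p.2 * w₂))) (𝓝 (φ, φ)) =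
    𝓝 (cos φ * u₁ - sin φ * u₂ + (cos φ * w₁ - sin φ * w₂),
      sin φ * u₁ + cos φ * u₂ + (sin φ * w₁ + cos φ * w₂)) := by
  have hf : HasStrictFDerivAt (𝕜 := ℝ) (fun p : ℝ × ℝ => p.1) (ContinuousLinearMap.fst ℝ ℝ ℝ)
    (φ, φ) := hasStrictFDerivAt_fst
  have hs : HasStrictFDerivAt (𝕜 := ℝ) (fun p : ℝ × ℝ => p.2) (ContinuousLinearMap.snd ℝ ℝ ℝ)
    (φ, φ) := hasStrictFDerivAt_snd
  have key := (((hf.cos.mul_const u₁).sub (hf.sin.mul_const u₂)).add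
      ((hs.cos.mul_const w₁).sub (hs.sin.mul_const w₂))).prodMk
    (((hf.sin.mul_const u₁).add (hf.cos.mul_const u₂)).add
      ((hs.sin.mul_const w₁).add (hs.cos.mul_const w₂)))
  refine key.map_nhds_eq_of_surj (LinearMap.range_eq_top.2 ?_)
  rintro ⟨a, b⟩
  have hsc := sin_sq_add_cos_sq φ
  obtain ⟨D, hD⟩ : ∃ D, D = u₁ * w₂ - u₂ * w₁ := ⟨_, rfl⟩
  rw [← hD] at h
  refine ⟨((a * (cos φ * w₁ - sin φ * w₂) + b * (sin φ * w₁ + cos φ * w₂)) / D,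
    -(a * (cos φ * u₁ - sin φ * u₂) + b * (sin φ * u₁ + cos φ * u₂)) / D), ?_⟩
  ext
  · simp
    field_simp
    linear_combination (a * (u₁ * w₂ - u₂ * w₁)) * hsc - a * hD
  · simp
    field_simp
    linear_combination (b * (u₁ * w₂ - u₂ * w₁)) * hsc - b * hD

open Filter Topology in
/-- Local controllability of a planar system with a one-dimensional shape, provided that shape
changes and, at nonzero shapes, rotations can be performed slowly, and that the rotation centres
at small shapes are not collinear. -/
lemma eventually_steer {f : (Fin 4 → ℝ) → ℝ → ℝ → Fin 4 → ℝ} {W : Set (Fin 4 → ℝ)} {B₁ B₂ T : ℝ}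
    {P₁ P₂ Θ a₁ a₂ r b₁ b₂ : ℝ → ℝ} (hΘ : ∀ a, HasDerivAt Θ (r a) a)
    (hP₁ : ∀ a, HasDerivAt P₁ (cos (Θ a) * a₁ a - sin (Θ a) * a₂ a) a)
    (hP₂ : ∀ a, HasDerivAt P₂ (sin (Θ a) * a₁ a + cos (Θ a) * a₂ a) a)
    (hΘ0 : Θ 0 = 0) (hP₁0 : P₁ 0 = 0) (hP₂0 : P₂ 0 = 0)
    (ha₁ : Continuous a₁) (ha₂ : Continuous a₂) (hr : Continuous r) {δ σ : ℝ} (hδ : 0 < δ)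
    (hσ : 0 < σ)
    (hshape : ∀ s : ℝ, |s| < σ → ∃ u w : ℝ → ℝ, Measurable u ∧ Measurable w ∧ ∀ α, |α| < δ →
      |u α| < B₁ ∧ |w α| < B₂ ∧ ∀ z : Fin 4 → ℝ, z 3 = α →
        f z (u α) (w α) = s • (Rtil (z 2)).mulVec ![a₁ α, a₂ α, r α, 1])
    (hrot : ∀ α, |α| < δ → α ≠ 0 → ∃ σ' > 0, ∀ s : ℝ, |s| < σ' → ∃ u w : ℝ, |u| < B₁ ∧ |w| < B₂ ∧
      ∀ z : Fin 4 → ℝ, z 3 = α → f z u w = s • (Rtil (z 2)).mulVec ![b₁ α, b₂ α, 1, 0])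
    (hcol : ∀ ρ > 0, ∃ a b c : ℝ, (|a| < ρ ∧ |b| < ρ ∧ |c| < ρ) ∧ (a ≠ 0 ∧ b ≠ 0 ∧ c ≠ 0) ∧
      (centre₁ P₁ Θ b₁ b₂ b - centre₁ P₁ Θ b₁ b₂ a) * (centre₂ P₂ Θ b₁ b₂ c - centre₂ P₂ Θ b₁ b₂ b)
      - (centre₂ P₂ Θ b₁ b₂ b - centre₂ P₂ Θ b₁ b₂ a) *
        (centre₁ P₁ Θ b₁ b₂ c - centre₁ P₁ Θ b₁ b₂ b) ≠ 0)
    {xe ye the : ℝ} (hW : W ∈ 𝓝 ![xe, ye, the, 0]) (hT : 0 < T) :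
    ∀ᶠ p : (Fin 4 → ℝ) × (Fin 4 → ℝ) in 𝓝 (![xe, ye, the, 0], ![xe, ye, the, 0]),
      Steer f W B₁ B₂ T p.1 p.2 := by
  have cΘ : Continuous Θ := continuous_iff_continuousAt.2 fun a => (hΘ a).continuousAt
  have cP₁ : Continuous P₁ := continuous_iff_continuousAt.2 fun a => (hP₁ a).continuousAt
  have cP₂ : Continuous P₂ := continuous_iff_continuousAt.2 fun a => (hP₂ a).continuousAt
  obtain ⟨τ, hτ⟩ : ∃ τ, τ = T / 7 := ⟨_, rfl⟩
  have hτ0 : 0 < τ := by rw [hτ]; positivity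
  have hbox : ∀ᶠ v : (ℝ × ℝ × ℝ) × ℝ in 𝓝 ((xe, ye, the), 0),
      placed P₁ P₂ Θ v.1.1 v.1.2.1 v.1.2.2 v.2 ∈ W := by
    have hc : Continuous fun v : (ℝ × ℝ × ℝ) × ℝ => placed P₁ P₂ Θ v.1.1 v.1.2.1 v.1.2.2 v.2 :=
      (continuous_placed cP₁ cP₂ cΘ).comp (by fun_prop :
        Continuous fun v : (ℝ × ℝ × ℝ) × ℝ => (v.1.1, v.1.2.1, v.1.2.2, v.2))
    refine (hc.tendsto' _ ![xe, ye, the, 0] ?_).eventually hW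
    simp [placed, hP₁0, hP₂0, hΘ0]
  rw [nhds_prod_eq, eventually_prod_iff] at hbox
  obtain ⟨inBox, hinBox, inShape, hinShape, hbox⟩ := hbox
  obtain ⟨ρ₀, hρ₀, hρ⟩ := Metric.eventually_nhds_iff.1 hinShape
  simp only [dist_zero_right, Real.norm_eq_abs] at hρ
  obtain ⟨ρ, hρ0, hρρ₀, hρδ, hρσ⟩ : ∃ ρ > 0, ρ ≤ ρ₀ ∧ ρ ≤ δ ∧ 2 * ρ < σ * τ := by
    refine ⟨min (min ρ₀ δ) (σ * τ / 4), by positivity, (min_le_left _ _).trans (min_le_left _ _),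
      (min_le_left _ _).trans (min_le_right _ _), ?_⟩
    have := min_le_right (min ρ₀ δ) (σ * τ / 4)
    have : 0 < σ * τ := by positivity
    linarith
  have hA : ∀ᶠ v : ℝ × ℝ × ℝ in 𝓝 (xe, ye, the), ∀ α β, |α| < ρ → |β| < ρ →
      Steer f W B₁ B₂ τ (placed P₁ P₂ Θ v.1 v.2.1 v.2.2 α) (placed P₁ P₂ Θ v.1 v.2.1 v.2.2 β) := by
    filter_upwards [hinBox] with v hv α β hα hβ
    refine steer_shape hΘ hP₁ hP₂ ha₁ ha₂ hr hτ0 (fun s hs => ?_)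
      (fun α hα => hbox hv (hρ (hα.trans_le hρρ₀))) hα hβ
    obtain ⟨u, w, hu, hw, huw⟩ := hshape s (lt_of_mul_lt_mul_right (hs.trans_lt hρσ) hτ0.le)
    exact ⟨u, w, hu, hw, fun α hα => huw α (hα.trans_le hρδ)⟩
  have hY : ∀ α, |α| < ρ → α ≠ 0 → ∀ᶠ v : ℝ × ℝ × ℝ × ℝ in 𝓝 (xe, ye, the, the),
      Steer f W B₁ B₂ τ (placed P₁ P₂ Θ v.1 v.2.1 v.2.2.1 α) (placed P₁ P₂ Θ
      (v.1 + (cos v.2.2.1 * centre₁ P₁ Θ b₁ b₂ α - sin v.2.2.1 * centre₂ P₂ Θ b₁ b₂ α)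
        - (cos v.2.2.2 * centre₁ P₁ Θ b₁ b₂ α - sin v.2.2.2 * centre₂ P₂ Θ b₁ b₂ α))
      (v.2.1 + (sin v.2.2.1 * centre₁ P₁ Θ b₁ b₂ α + cos v.2.2.1 * centre₂ P₂ Θ b₁ b₂ α)
        - (sin v.2.2.2 * centre₁ P₁ Θ b₁ b₂ α + cos v.2.2.2 * centre₂ P₂ Θ b₁ b₂ α))
        v.2.2.2 α) := by
    intro α hα hα0
    obtain ⟨σ', hσ', hctrl⟩ := hrot α (hα.trans_le hρδ) hα0
    have hin : ∀ᶠ v : (ℝ × ℝ × ℝ) × ℝ in 𝓝 ((xe, ye, the), the), inBox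
        (v.1.1 + (cos v.1.2.2 * centre₁ P₁ Θ b₁ b₂ α - sin v.1.2.2 * centre₂ P₂ Θ b₁ b₂ α)
          - (cos v.2 * centre₁ P₁ Θ b₁ b₂ α - sin v.2 * centre₂ P₂ Θ b₁ b₂ α),
        v.1.2.1 + (sin v.1.2.2 * centre₁ P₁ Θ b₁ b₂ α + cos v.1.2.2 * centre₂ P₂ Θ b₁ b₂ α)
          - (sin v.2 * centre₁ P₁ Θ b₁ b₂ α + cos v.2 * centre₂ P₂ Θ b₁ b₂ α), v.2) :=
      (Continuous.tendsto' (by fun_prop) _ _ (by simp)).eventually hinBox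
    rw [nhds_prod_eq, eventually_prod_iff] at hin
    obtain ⟨pa, hpa, pb, hpb, hin⟩ := hin
    obtain ⟨η, hη, hball⟩ := Metric.eventually_nhds_iff_ball.1 hpb
    have h₁ : ∀ᶠ v : ℝ × ℝ × ℝ × ℝ in 𝓝 (xe, ye, the, the), pa (v.1, v.2.1, v.2.2.1) :=
      (Continuous.tendsto' (by fun_prop) _ _ rfl).eventually hpa
    have h₂ : ∀ᶠ v : ℝ × ℝ × ℝ × ℝ in 𝓝 (xe, ye, the, the), v.2.2.1 ∈ Metric.ball the η :=
      (Continuous.tendsto' (by fun_prop) _ _ rfl).eventually (Metric.ball_mem_nhds _ hη)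
    have h₃ : ∀ᶠ v : ℝ × ℝ × ℝ × ℝ in 𝓝 (xe, ye, the, the), v.2.2.2 ∈ Metric.ball the η :=
      (Continuous.tendsto' (by fun_prop) _ _ rfl).eventually (Metric.ball_mem_nhds _ hη)
    have h₄ : ∀ᶠ v : ℝ × ℝ × ℝ × ℝ in 𝓝 (xe, ye, the, the), |v.2.2.2 - v.2.2.1| < σ' * τ := by
      have : Tendsto (fun v : ℝ × ℝ × ℝ × ℝ => |v.2.2.2 - v.2.2.1|) (𝓝 (xe, ye, the, the)) (𝓝 0) :=
        Continuous.tendsto' (by fun_prop) _ _ (by simp)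
      exact this.eventually (gt_mem_nhds (by positivity))
    filter_upwards [h₁, h₂, h₃, h₄] with v hv₁ hv₂ hv₃ hv₄
    refine steer_rotate hτ0 (fun s hs => hctrl s (lt_of_mul_lt_mul_right hs hτ0.le)) hv₄
      fun ω hω => hbox (hin hv₁ (hball ω ?_)) (hρ (hα.trans_le hρρ₀))
    exact (convex_ball the η).ordConnected.uIcc_subset hv₂ hv₃ hω
  obtain ⟨a, b, c, ⟨ha, hb, hc⟩, ⟨ha0, hb0, hc0⟩, hcross⟩ := hcol ρ hρ0
  have hYa := hY a ha ha0
  have hYb := hY b hb hb0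
  have hYc := hY c hc hc0
  generalize centre₁ P₁ Θ b₁ b₂ a = m₁ at *
  generalize centre₂ P₂ Θ b₁ b₂ a = m₂ at *
  generalize centre₁ P₁ Θ b₁ b₂ b = n₁ at *
  generalize centre₂ P₂ Θ b₁ b₂ b = n₂ at *
  generalize centre₁ P₁ Θ b₁ b₂ c = o₁ at *
  generalize centre₂ P₂ Θ b₁ b₂ c = o₂ at *
  have hall : ∀ᶠ v : (ℝ × ℝ × ℝ × ℝ) × (ℝ × ℝ) in 𝓝 ((xe, ye, the, the), (the, the)),
      ∀ α β, |α| < ρ → |β| < ρ → Steer f W B₁ B₂ T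
        (placed P₁ P₂ Θ v.1.1 v.1.2.1 v.1.2.2.1 α)
        (placed P₁ P₂ Θ
          (v.1.1 + (cos v.1.2.2.1 * m₁ - sin v.1.2.2.1 * m₂) - (cos v.2.1 * m₁ - sin v.2.1 * m₂)
            + (cos v.2.1 * n₁ - sin v.2.1 * n₂) - (cos v.2.2 * n₁ - sin v.2.2 * n₂)
            + (cos v.2.2 * o₁ - sin v.2.2 * o₂) - (cos v.1.2.2.2 * o₁ - sin v.1.2.2.2 * o₂))
          (v.1.2.1 + (sin v.1.2.2.1 * m₁ + cos v.1.2.2.1 * m₂) - (sin v.2.1 * m₁ + cos v.2.1 * m₂)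
            + (sin v.2.1 * n₁ + cos v.2.1 * n₂) - (sin v.2.2 * n₁ + cos v.2.2 * n₂)
            + (sin v.2.2 * o₁ + cos v.2.2 * o₂) - (sin v.1.2.2.2 * o₁ + cos v.1.2.2.2 * o₂))
          v.1.2.2.2 β) := by
    have e₁ : Tendsto (fun v : (ℝ × ℝ × ℝ × ℝ) × (ℝ × ℝ) => (v.1.1, v.1.2.1, v.1.2.2.1))
        (𝓝 ((xe, ye, the, the), (the, the))) (𝓝 (xe, ye, the)) :=
      Continuous.tendsto' (by fun_prop) _ _ rfl
    have e₂ : Tendsto (fun v : (ℝ × ℝ × ℝ × ℝ) × (ℝ × ℝ) => (v.1.1, v.1.2.1, v.1.2.2.1, v.2.1))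
        (𝓝 ((xe, ye, the, the), (the, the))) (𝓝 (xe, ye, the, the)) :=
      Continuous.tendsto' (by fun_prop) _ _ rfl
    have e₃ : Tendsto (fun v : (ℝ × ℝ × ℝ × ℝ) × (ℝ × ℝ) =>
        (v.1.1 + (cos v.1.2.2.1 * m₁ - sin v.1.2.2.1 * m₂) - (cos v.2.1 * m₁ - sin v.2.1 * m₂),
        v.1.2.1 + (sin v.1.2.2.1 * m₁ + cos v.1.2.2.1 * m₂) - (sin v.2.1 * m₁ + cos v.2.1 * m₂),
        v.2.1, v.2.2)) (𝓝 ((xe, ye, the, the), (the, the))) (𝓝 (xe, ye, the, the)) :=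
      Continuous.tendsto' (by fun_prop) _ _ (by simp)
    have e₄ : Tendsto (fun v : (ℝ × ℝ × ℝ × ℝ) × (ℝ × ℝ) =>
        (v.1.1 + (cos v.1.2.2.1 * m₁ - sin v.1.2.2.1 * m₂) - (cos v.2.1 * m₁ - sin v.2.1 * m₂)
          + (cos v.2.1 * n₁ - sin v.2.1 * n₂) - (cos v.2.2 * n₁ - sin v.2.2 * n₂),
        v.1.2.1 + (sin v.1.2.2.1 * m₁ + cos v.1.2.2.1 * m₂) - (sin v.2.1 * m₁ + cos v.2.1 * m₂)
          + (sin v.2.1 * n₁ + cos v.2.1 * n₂) - (sin v.2.2 * n₁ + cos v.2.2 * n₂),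
        v.2.2, v.1.2.2.2)) (𝓝 ((xe, ye, the, the), (the, the))) (𝓝 (xe, ye, the, the)) :=
      Continuous.tendsto' (by fun_prop) _ _ (by simp)
    have e₅ : Tendsto (fun v : (ℝ × ℝ × ℝ × ℝ) × (ℝ × ℝ) =>
        (v.1.1 + (cos v.1.2.2.1 * m₁ - sin v.1.2.2.1 * m₂) - (cos v.2.1 * m₁ - sin v.2.1 * m₂)
          + (cos v.2.1 * n₁ - sin v.2.1 * n₂) - (cos v.2.2 * n₁ - sin v.2.2 * n₂)
          + (cos v.2.2 * o₁ - sin v.2.2 * o₂) - (cos v.1.2.2.2 * o₁ - sin v.1.2.2.2 * o₂),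
        v.1.2.1 + (sin v.1.2.2.1 * m₁ + cos v.1.2.2.1 * m₂) - (sin v.2.1 * m₁ + cos v.2.1 * m₂)
          + (sin v.2.1 * n₁ + cos v.2.1 * n₂) - (sin v.2.2 * n₁ + cos v.2.2 * n₂)
          + (sin v.2.2 * o₁ + cos v.2.2 * o₂) - (sin v.1.2.2.2 * o₁ + cos v.1.2.2.2 * o₂),
        v.1.2.2.2)) (𝓝 ((xe, ye, the, the), (the, the))) (𝓝 (xe, ye, the)) :=
      Continuous.tendsto' (by fun_prop) _ _ (by simp)
    have p₃ : Tendsto (fun v : ℝ × ℝ × ℝ × ℝ => (v.1, v.2.1, v.2.2.1))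
        (𝓝 (xe, ye, the, the)) (𝓝 (xe, ye, the)) := Continuous.tendsto' (by fun_prop) _ _ rfl
    filter_upwards [e₁.eventually hA, e₂.eventually hYa, (p₃.comp e₃).eventually hA,
      e₃.eventually hYb, (p₃.comp e₄).eventually hA, e₄.eventually hYc, e₅.eventually hA]
      with v h₁ h₂ h₃ h₄ h₅ h₆ h₇ α β hα hβ
    have hT7 : T = τ + (τ + (τ + (τ + (τ + (τ + τ))))) := by rw [hτ]; ring
    rw [hT7]
    exact (h₁ α a hα ha).trans hτ0.le (by positivity) <| h₂.trans hτ0.le (by positivity) <|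
      (h₃ a b ha hb).trans hτ0.le (by positivity) <| h₄.trans hτ0.le (by positivity) <|
      (h₅ b c hb hc).trans hτ0.le (by positivity) <| h₆.trans hτ0.le hτ0.le (h₇ c β hc hβ)
  rw [nhds_prod_eq, eventually_prod_iff] at hall
  obtain ⟨pa, hpa, pb, hpb, hall⟩ := hall
  have hreach := image_mem_map (m := fun p : ℝ × ℝ =>
    (cos p.1 * (n₁ - m₁) - sin p.1 * (n₂ - m₂) + (cos p.2 * (o₁ - n₁) - sin p.2 * (o₂ - n₂)),
      sin p.1 * (n₁ - m₁) + cos p.1 * (n₂ - m₂) + (sin p.2 * (o₁ - n₁) + cos p.2 * (o₂ - n₂)))) hpb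
  rw [map_twoLink_nhds hcross the] at hreach
  let X : (Fin 4 → ℝ) → ℝ := fun z =>
    z 0 - (cos (z 2 - Θ (z 3)) * P₁ (z 3) - sin (z 2 - Θ (z 3)) * P₂ (z 3))
  let Y : (Fin 4 → ℝ) → ℝ := fun z =>
    z 1 - (sin (z 2 - Θ (z 3)) * P₁ (z 3) + cos (z 2 - Θ (z 3)) * P₂ (z 3))
  let A : (Fin 4 → ℝ) → ℝ := fun z => z 2 - Θ (z 3)
  have cX : Continuous X := by fun_prop
  have cY : Continuous Y := by fun_prop
  have cA : Continuous A := by fun_prop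
  have X0 : X ![xe, ye, the, 0] = xe := by simp [X, hP₁0, hP₂0]
  have Y0 : Y ![xe, ye, the, 0] = ye := by simp [Y, hP₁0, hP₂0]
  have A0 : A ![xe, ye, the, 0] = the := by simp [A, hΘ0]
  have k₁ : Tendsto (fun p : (Fin 4 → ℝ) × (Fin 4 → ℝ) => (X p.1, Y p.1, A p.1, A p.2))
      (𝓝 (![xe, ye, the, 0], ![xe, ye, the, 0])) (𝓝 (xe, ye, the, the)) :=
    Continuous.tendsto' (by fun_prop) _ _ (by simp only [X0, Y0, A0])
  have k₂ : Tendsto (fun p : (Fin 4 → ℝ) × (Fin 4 → ℝ) =>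
      (X p.2 + (cos (A p.2) * o₁ - sin (A p.2) * o₂) - X p.1
        - (cos (A p.1) * m₁ - sin (A p.1) * m₂),
      Y p.2 + (sin (A p.2) * o₁ + cos (A p.2) * o₂) - Y p.1
        - (sin (A p.1) * m₁ + cos (A p.1) * m₂)))
      (𝓝 (![xe, ye, the, 0], ![xe, ye, the, 0])) (𝓝
        (cos the * (n₁ - m₁) - sin the * (n₂ - m₂) + (cos the * (o₁ - n₁) - sin the * (o₂ - n₂)),
        sin the * (n₁ - m₁) + cos the * (n₂ - m₂)
          + (sin the * (o₁ - n₁) + cos the * (o₂ - n₂)))) :=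
    Continuous.tendsto' (by fun_prop) _ _ (by
      simp only [X0, Y0, A0]
      ext <;> simp only <;> ring)
  have k₃ : Tendsto (fun p : (Fin 4 → ℝ) × (Fin 4 → ℝ) => |p.1 3|)
      (𝓝 (![xe, ye, the, 0], ![xe, ye, the, 0])) (𝓝 0) :=
    Continuous.tendsto' (by fun_prop) _ _ (by simp)
  have k₄ : Tendsto (fun p : (Fin 4 → ℝ) × (Fin 4 → ℝ) => |p.2 3|)
      (𝓝 (![xe, ye, the, 0], ![xe, ye, the, 0])) (𝓝 0) :=
    Continuous.tendsto' (by fun_prop) _ _ (by simp)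
  filter_upwards [k₁.eventually hpa, k₂.eventually hreach, k₃.eventually (gt_mem_nhds hρ0),
    k₄.eventually (gt_mem_nhds hρ0)] with p h₁ h₂ h₃ h₄
  obtain ⟨q, hq, hqp⟩ := h₂
  simp only [Prod.mk.injEq] at hqp
  have key := hall h₁ hq (p.1 3) (p.2 3) h₃ h₄
  convert key using 1
  · exact (placed_coords p.1).symm
  · refine (placed_coords (P₁ := P₁) (P₂ := P₂) (Θ := Θ) p.2).symm.trans ?_
    congr 1
    · change X p.2 = _
      linear_combination -hqp.1
    · change Y p.2 = _
      linear_combination -hqp.2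

section Swimmer

variable {l1 l2 x1 x2 e1 e2 k M1 M2 : ℝ}

/-- Controls realising `s` times a body velocity `B` that exerts no drag force. -/
lemma controlled_field_eq {z B : Fin 4 → ℝ} {p q s u w : ℝ}
    (hdet : (Emat l1 l2 x1 x2 e1 e2 (z 3)).det ≠ 0)
    (hB : (Emat l1 l2 x1 x2 e1 e2 (z 3)).mulVec B = ![0, 0, p, q])
    (hw : M2 * w = k * z 3 - s * q)
    (hu : M1 * sin (z 3) * u - (M1 * cos (z 3) + M2) * w = s * p) :
    F0 l1 l2 x1 x2 e1 e2 k z + u • F1 l1 l2 x1 x2 e1 e2 M1 z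
      + w • F2 l1 l2 x1 x2 e1 e2 M1 M2 z = s • (Rtil (z 2)).mulVec B := by
  have hB' : B = (Emat l1 l2 x1 x2 e1 e2 (z 3))⁻¹.mulVec ![0, 0, p, q] := by
    rw [← hB, Matrix.mulVec_mulVec, Matrix.nonsing_inv_mul _ (Ne.isUnit hdet), Matrix.one_mulVec]
  have hcol : B = p • (fun i => (Emat l1 l2 x1 x2 e1 e2 (z 3))⁻¹ i 2)
      + q • (fun i => (Emat l1 l2 x1 x2 e1 e2 (z 3))⁻¹ i 3) := by
    rw [hB']
    ext i
    simp [Matrix.mulVec, dotProduct, Fin.sum_univ_four, mul_comm]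
  have hF : (Rtil (z 2)).mulVec B = p • X3 l1 l2 x1 x2 e1 e2 z + q • X4 l1 l2 x1 x2 e1 e2 z := by
    rw [hcol, Matrix.mulVec_add, Matrix.mulVec_smul, Matrix.mulVec_smul]
    rfl
  rw [hF]
  ext i
  simp only [F0, F1, F2, Pi.add_apply, Pi.smul_apply, Pi.sub_apply, smul_eq_mul]
  linear_combination (X3 l1 l2 x1 x2 e1 e2 z i) * hu - (X4 l1 l2 x1 x2 e1 e2 z i) * hw

/-- The controls of `controlled_field_eq`, solved for explicitly. -/
lemma controlled_field_eq_of_drag {z B : Fin 4 → ℝ} {p q s : ℝ} (hM1 : M1 ≠ 0) (hM2 : M2 ≠ 0)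
    (hdet : (Emat l1 l2 x1 x2 e1 e2 (z 3)).det ≠ 0)
    (hB : (Emat l1 l2 x1 x2 e1 e2 (z 3)).mulVec B = ![0, 0, p, q])
    (hsin : sin (z 3) ≠ 0 ∨ z 3 = 0 ∧ M2 * p - q * (M1 * cos (z 3) + M2) = 0) :
    F0 l1 l2 x1 x2 e1 e2 k z
      + ((s * (M2 * p - q * (M1 * cos (z 3) + M2)) + k * z 3 * (M1 * cos (z 3) + M2))
        / (M1 * M2 * sin (z 3))) • F1 l1 l2 x1 x2 e1 e2 M1 z
      + ((k * z 3 - s * q) / M2) • F2 l1 l2 x1 x2 e1 e2 M1 M2 z = s • (Rtil (z 2)).mulVec B := by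
  refine controlled_field_eq hdet hB (by field_simp) ?_
  rcases hsin with h | ⟨h, h'⟩
  · field_simp
    ring
  · rw [h] at h' ⊢
    simp only [cos_zero, mul_one, sin_zero] at h' ⊢
    field_simp
    linear_combination -s * h'

open Filter Topology in
/-- The feedback cancelling the elastic torque, and realising a slow multiple of a field without
singular part, stays within the admissible bounds at small shapes. -/
lemma eventually_controls_lt {G q : ℝ → ℝ} {ε : ℝ} (hε : 0 < ε) (hk : 0 < k) (hM1 : M1 ≠ 0)
    (hM2 : M2 ≠ 0) (hG : DifferentiableAt ℝ G 0) (hG0 : G 0 = 0) (hq : ContinuousAt q 0) :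
    ∃ σ > 0, ∀ᶠ α in 𝓝 (0 : ℝ), ∀ s : ℝ, |s| < σ →
      |(s * G α + k * α * (M1 * cos α + M2)) / (M1 * M2 * sin α)|
        < 2 * k * |(M2 + M1) / (M2 * M1)| + ε ∧ |(k * α - s * q α) / M2| < ε := by
  obtain ⟨C, hC, hGC⟩ := (hG.hasDerivAt.isBigO_sub).exists_pos
  have hGC := hGC.bound
  simp only [hG0, sub_zero, Real.norm_eq_abs] at hGC
  have hM : 0 < |M1 * M2| := abs_pos.2 (mul_ne_zero hM1 hM2)
  have hc : ∀ᶠ α in 𝓝 (0 : ℝ), 2 * k * |(M2 + M1 * cos α) / (M2 * M1)|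
      < 2 * k * |(M2 + M1) / (M2 * M1)| + ε / 2 := by
    have h : Tendsto (fun α => 2 * k * |(M2 + M1 * cos α) / (M2 * M1)|) (𝓝 0)
        (𝓝 (2 * k * |(M2 + M1) / (M2 * M1)|)) :=
      Continuous.tendsto' (by fun_prop) _ _ (by simp)
    exact h.eventually (gt_mem_nhds (by linarith))
  have hq' : ∀ᶠ α in 𝓝 (0 : ℝ), |q α| < |q 0| + 1 :=
    hq.abs.eventually (gt_mem_nhds (by linarith))
  have hα : ∀ᶠ α in 𝓝 (0 : ℝ), |k * α| < ε * |M2| / 2 := by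
    have h : Tendsto (fun α : ℝ => |k * α|) (𝓝 0) (𝓝 0) :=
      Continuous.tendsto' (by fun_prop) _ _ (by simp)
    exact h.eventually (gt_mem_nhds (by positivity))
  have h1 : ∀ᶠ α in 𝓝 (0 : ℝ), |α| < 1 :=
    continuous_abs.continuousAt.eventually (gt_mem_nhds (by simp))
  refine ⟨min (ε * |M1 * M2| / (4 * C)) (ε * |M2| / (2 * (|q 0| + 1))), by positivity, ?_⟩
  filter_upwards [hGC, hc, hq', hα, h1] with α hGC hc hq' hα h1 s hs
  have hs₁ := (hs.trans_le (min_le_left _ _)).le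
  have hs₂ := (hs.trans_le (min_le_right _ _)).le
  rw [le_div_iff₀ (by positivity)] at hs₁ hs₂
  constructor
  · rcases eq_or_ne α 0 with rfl | h0
    · simp only [sin_zero, mul_zero, div_zero, abs_zero]
      positivity
    have hsin : |α| ≤ 2 * |sin α| := by
      have h := Real.mul_le_sin (abs_nonneg α) (by linarith [Real.pi_gt_three])
      have h2 : sin |α| ≤ |sin α| := by
        rcases abs_cases α with ⟨h, -⟩ | ⟨h, -⟩ <;> rw [h]
        · exact le_abs_self _
        · rw [sin_neg]; exact neg_le_abs _
      have h3 : 1 / 2 * |α| ≤ 2 / π * |α| := by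
        gcongr ?_ * _
        rw [div_le_div_iff₀ two_pos pi_pos]
        linarith [Real.pi_le_four]
      linarith
    have hα0 : 0 < |α| := abs_pos.2 h0
    have hs0 : 0 < |sin α| := by linarith
    have e : (s * G α + k * α * (M1 * cos α + M2)) / (M1 * M2 * sin α)
        = s * G α / (M1 * M2 * sin α) + k * (α / sin α) * ((M2 + M1 * cos α) / (M2 * M1)) := by
      have := abs_pos.1 hs0
      field_simp
      ring
    rw [e]
    refine (abs_add_le _ _).trans_lt ?_
    have b₁ : |s * G α / (M1 * M2 * sin α)| ≤ ε / 2 := by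
      rw [abs_div, abs_mul, abs_mul, div_le_iff₀ (by positivity)]
      calc |s| * |G α| ≤ |s| * (C * (2 * |sin α|)) := by
            gcongr
            exact hGC.trans (by gcongr)
        _ = |s| * (4 * C) * (|sin α| / 2) := by ring
        _ ≤ ε * |M1 * M2| * (|sin α| / 2) := by gcongr
        _ = _ := by ring
    have b₂ : |k * (α / sin α) * ((M2 + M1 * cos α) / (M2 * M1))|
        ≤ 2 * k * |(M2 + M1 * cos α) / (M2 * M1)| := by
      rw [abs_mul, abs_mul, abs_of_pos hk]
      have : |α / sin α| ≤ 2 := by rwa [abs_div, div_le_iff₀ hs0]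
      rw [mul_comm 2 k]
      gcongr
    linarith
  · rw [abs_div, div_lt_iff₀ (abs_pos.2 hM2)]
    refine (abs_sub _ _).trans_lt ?_
    rw [abs_mul s]
    have : |s| * |q α| ≤ |s| * (|q 0| + 1) := by gcongr
    linarith

end Swimmer

open Filter Topology in
/-- A curve whose velocity, in a rotating frame, has an odd first and an even second coordinate is
not contained in a line near the origin, unless its frame rotates oddly. -/
lemma exists_not_collinear {m₁ m₂ Θ v₁ v₂ : ℝ → ℝ}
    (hm₁ : ∀ α, HasDerivAt m₁ (cos (Θ α) * v₁ α - sin (Θ α) * v₂ α) α)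
    (hm₂ : ∀ α, HasDerivAt m₂ (sin (Θ α) * v₁ α + cos (Θ α) * v₂ α) α)
    (hΘ : Continuous Θ) (hv₁ : Continuous v₁) (hv₂ : Continuous v₂) (hΘ0 : Θ 0 = 0)
    (hodd : ∀ α, v₁ (-α) = -v₁ α) (heven : ∀ α, v₂ (-α) = v₂ α) (hv₂0 : v₂ 0 ≠ 0)
    (hsum : ∃ᶠ α in 𝓝[≠] 0, sin (Θ α + Θ (-α)) ≠ 0) (ρ : ℝ) (hρ : 0 < ρ) :
    ∃ a b c : ℝ, (|a| < ρ ∧ |b| < ρ ∧ |c| < ρ) ∧ (a ≠ 0 ∧ b ≠ 0 ∧ c ≠ 0) ∧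
      (m₁ b - m₁ a) * (m₂ c - m₂ b) - (m₂ b - m₂ a) * (m₁ c - m₁ b) ≠ 0 := by
  by_contra! H
  have hU : ∀ a : ℝ, |a| < ρ → a ≠ 0 → ∀ᶠ b in 𝓝 a, |b| < ρ ∧ b ≠ 0 := fun a ha ha0 =>
    (continuous_abs.continuousAt.eventually (gt_mem_nhds ha)).and (eventually_ne_nhds ha0)
  have hc : ∀ a b c : ℝ, |a| < ρ → |b| < ρ → |c| < ρ → a ≠ 0 → b ≠ 0 → c ≠ 0 →
      (m₁ b - m₁ a) * (sin (Θ c) * v₁ c + cos (Θ c) * v₂ c)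
        - (m₂ b - m₂ a) * (cos (Θ c) * v₁ c - sin (Θ c) * v₂ c) = 0 := by
    intro a b c ha hb hc ha0 hb0 hc0
    refine ((((hm₂ c).sub_const (m₂ b)).const_mul (m₁ b - m₁ a)).sub
      (((hm₁ c).sub_const (m₁ b)).const_mul (m₂ b - m₂ a))).unique
      ((hasDerivAt_const c (0 : ℝ)).congr_of_eventuallyEq ?_)
    filter_upwards [hU c hc hc0] with c' hc'
    exact H a b c' ⟨ha, hb, hc'.1⟩ ⟨ha0, hb0, hc'.2⟩
  have hbc : ∀ b c : ℝ, |b| < ρ → |c| < ρ → b ≠ 0 → c ≠ 0 →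
      (cos (Θ b) * v₁ b - sin (Θ b) * v₂ b) * (sin (Θ c) * v₁ c + cos (Θ c) * v₂ c)
        - (sin (Θ b) * v₁ b + cos (Θ b) * v₂ b) * (cos (Θ c) * v₁ c - sin (Θ c) * v₂ c) = 0 := by
    intro b c hb hc' hb0 hc0
    refine ((((hm₁ b).sub_const (m₁ b)).mul_const _).sub
      (((hm₂ b).sub_const (m₂ b)).mul_const _)).unique
      ((hasDerivAt_const b (0 : ℝ)).congr_of_eventuallyEq ?_)
    filter_upwards [hU b hb hb0] with b' hb'
    exact hc b b' c hb hb'.1 hc' hb0 hb'.2 hc0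
  have hv₁0 : v₁ 0 = 0 := by
    have := hodd 0
    rw [neg_zero] at this
    linarith
  have hperp : ∀ c : ℝ, |c| < ρ → c ≠ 0 → cos (Θ c) * v₁ c - sin (Θ c) * v₂ c = 0 := by
    intro c hc' hc0
    have hlim : Tendsto (fun b =>
        (cos (Θ b) * v₁ b - sin (Θ b) * v₂ b) * (sin (Θ c) * v₁ c + cos (Θ c) * v₂ c)
        - (sin (Θ b) * v₁ b + cos (Θ b) * v₂ b) * (cos (Θ c) * v₁ c - sin (Θ c) * v₂ c))
        (𝓝[≠] 0) (𝓝 (-(v₂ 0 * (cos (Θ c) * v₁ c - sin (Θ c) * v₂ c)))) :=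
      (Continuous.tendsto' (by fun_prop) _ _ (by simp [hΘ0, hv₁0])).mono_left nhdsWithin_le_nhds
    have hzero : ∀ᶠ b in 𝓝[≠] (0 : ℝ), |b| < ρ ∧ b ≠ 0 :=
      ((continuous_abs.continuousAt.eventually (gt_mem_nhds (by simpa using hρ))).filter_mono
        nhdsWithin_le_nhds).and self_mem_nhdsWithin
    have h := tendsto_nhds_unique hlim (tendsto_const_nhds.congr'
      (hzero.mono fun b hb => (hbc b c hb.1 hc' hb.2 hc0).symm))
    exact (mul_eq_zero.1 (neg_eq_zero.1 h)).resolve_left hv₂0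
  have hev : ∀ᶠ α in 𝓝[≠] (0 : ℝ), |α| < ρ ∧ v₂ α ≠ 0 ∧ α ≠ 0 :=
    ((continuous_abs.continuousAt.eventually (gt_mem_nhds (by simpa using hρ))).filter_mono
      nhdsWithin_le_nhds).and (((hv₂.continuousAt.eventually_ne hv₂0).filter_mono
      nhdsWithin_le_nhds).and self_mem_nhdsWithin)
  obtain ⟨α, hα, hαρ, hα₂, hα0⟩ := (hsum.and_eventually hev).exists
  have h₁ := hperp α hαρ hα0
  have h₂ := hperp (-α) (by rwa [abs_neg]) (neg_ne_zero.2 hα0)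
  rw [hodd, heven] at h₂
  refine hα ((mul_eq_zero.1 ?_).resolve_left hα₂)
  rw [sin_add]
  linear_combination -cos (Θ (-α)) * h₁ - cos (Θ α) * h₂

section Drag

variable {l1 l2 x1 x2 e1 e2 : ℝ}

/-- Determinant of the translational drag matrix. -/
noncomputable def dragDet (c d g S α : ℝ) : ℝ := c * S * cos α ^ 2 + d * g * sin α ^ 2

lemma dragDet_pos {c d g S : ℝ} (hc : 0 < c) (hd : 0 < d) (hg : 0 < g) (hS : 0 < S) (α : ℝ) :
    0 < dragDet c d g S α := by
  have h := sin_sq_add_cos_sq α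
  unfold dragDet
  rcases (sq_nonneg (cos α)).eq_or_lt with h0 | h0
  · rw [← h0] at h ⊢
    rw [add_zero] at h
    rw [h]
    positivity
  · positivity

/-- First component of the translational velocity whose drag balances the force `(β₁, β₂)`. -/
noncomputable def slide₁ (c d g S : ℝ) (β₁ β₂ : ℝ → ℝ) (α : ℝ) : ℝ :=
  (S * cos α * β₁ α - d * sin α * β₂ α) / dragDet c d g S α

/-- Second component of the translational velocity whose drag balances the force `(β₁, β₂)`. -/
noncomputable def slide₂ (c d g S : ℝ) (β₁ β₂ : ℝ → ℝ) (α : ℝ) : ℝ :=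
  (g * sin α * β₁ α + c * cos α * β₂ α) / dragDet c d g S α

section Slide

variable {c d g S : ℝ} {β₁ β₂ : ℝ → ℝ}

lemma slide_balance₁ {α : ℝ} (hD : dragDet c d g S α ≠ 0) :
    -c * cos α * slide₁ c d g S β₁ β₂ α + -d * sin α * slide₂ c d g S β₁ β₂ α + β₁ α = 0 := by
  unfold slide₁ slide₂
  field_simp
  unfold dragDet
  ring

lemma slide_balance₂ {α : ℝ} (hD : dragDet c d g S α ≠ 0) :
    g * sin α * slide₁ c d g S β₁ β₂ α + -S * cos α * slide₂ c d g S β₁ β₂ α + β₂ α = 0 := by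
  unfold slide₁ slide₂
  field_simp
  unfold dragDet
  ring

lemma contDiff_dragDet : ContDiff ℝ 1 (dragDet c d g S) := by
  unfold dragDet
  fun_prop

lemma contDiff_slide₁ (hD : ∀ α, dragDet c d g S α ≠ 0) (h₁ : ContDiff ℝ 1 β₁)
    (h₂ : ContDiff ℝ 1 β₂) : ContDiff ℝ 1 (slide₁ c d g S β₁ β₂) :=
  ContDiff.div (by fun_prop) contDiff_dragDet hD

lemma contDiff_slide₂ (hD : ∀ α, dragDet c d g S α ≠ 0) (h₁ : ContDiff ℝ 1 β₁)
    (h₂ : ContDiff ℝ 1 β₂) : ContDiff ℝ 1 (slide₂ c d g S β₁ β₂) :=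
  ContDiff.div (by fun_prop) contDiff_dragDet hD

lemma slide₁_neg (h₁ : ∀ α, β₁ (-α) = -β₁ α) (h₂ : ∀ α, β₂ (-α) = β₂ α) (α : ℝ) :
    slide₁ c d g S β₁ β₂ (-α) = -slide₁ c d g S β₁ β₂ α := by
  unfold slide₁ dragDet
  rw [h₁, h₂, sin_neg, cos_neg]
  ring

lemma slide₂_neg (h₁ : ∀ α, β₁ (-α) = -β₁ α) (h₂ : ∀ α, β₂ (-α) = β₂ α) (α : ℝ) :
    slide₂ c d g S β₁ β₂ (-α) = slide₂ c d g S β₁ β₂ α := by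
  unfold slide₂ dragDet
  rw [h₁, h₂, sin_neg, cos_neg]
  ring

lemma hasDerivAt_slide₁_zero {μ : ℝ} (hD : dragDet c d g S 0 ≠ 0) (h₁ : HasDerivAt β₁ μ 0)
    (h₁0 : β₁ 0 = 0) (h₂ : DifferentiableAt ℝ β₂ 0) :
    HasDerivAt (slide₁ c d g S β₁ β₂) ((S * μ - d * β₂ 0) / (c * S)) 0 := by
  have hnum := (((hasDerivAt_cos 0).const_mul S).mul h₁).sub
    (((hasDerivAt_sin 0).const_mul d).mul h₂.hasDerivAt)
  have hden : HasDerivAt (dragDet c d g S) (deriv (dragDet c d g S) 0) 0 :=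
    (contDiff_dragDet.differentiable (by norm_num) 0).hasDerivAt
  refine (hnum.div hden hD).congr_deriv ?_
  have h0 : dragDet c d g S 0 = c * S := by simp [dragDet]
  rw [h0] at hD
  simp [h0, h₁0]
  field_simp

end Slide

lemma Emat_mulVec (α a b c d : ℝ) :
    (Emat l1 l2 x1 x2 e1 e2 α).mulVec ![a, b, c, d] =
      ![-(x1 * l1 + x2 * l2) * cos α * a + -(x1 * l1 + e2 * l2) * sin α * b
          + 1 / 2 * x1 * l1 * l2 * sin α * c,
        (e1 * l1 + x2 * l2) * sin α * a + -(e1 * l1 + e2 * l2) * cos α * b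
          + 1 / 2 * e1 * l1 * (l1 + l2 * cos α) * c + 1 / 2 * e1 * l1 ^ 2 * d,
        1 / 2 * (e1 * l1 ^ 2 * (-sin α)) * a + 1 / 2 * (e1 * l1 ^ 2 * cos α - e2 * l2 ^ 2) * b
          - (e1 * l1 ^ 2 * (1 / 4 * l2 * cos α + 1 / 3 * l1) + e2 * l2 ^ 2 * (1 / 12 * l2)) * c
          - e1 * l1 ^ 2 * (1 / 3 * l1) * d,
        -(1 / 2 * (e2 * l2 ^ 2)) * b - e2 * l2 ^ 2 * (1 / 12 * l2) * c] := by
  ext i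
  fin_cases i <;>
    simp [Emat, Matrix.mulVec, dotProduct, Fin.sum_univ_four] <;> ring

open Filter Topology in
lemma eventually_det_Emat_ne_zero (hl1 : 0 < l1) (hl2 : 0 < l2) (hx1 : 0 < x1) (hx2 : 0 < x2)
    (he1 : 0 < e1) (he2 : 0 < e2) : ∀ᶠ α in 𝓝 (0 : ℝ), (Emat l1 l2 x1 x2 e1 e2 α).det ≠ 0 := by
  have hc : Continuous fun α => (Emat l1 l2 x1 x2 e1 e2 α).det := by
    refine Continuous.matrix_det (continuous_matrix fun i j => ?_)
    fin_cases i <;> fin_cases j <;> simp [Emat] <;> fun_prop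
  have h0 : (Emat l1 l2 x1 x2 e1 e2 0).det =
      -((x1 * l1 + x2 * l2) * (e1 * l1 + e2 * l2) * e1 * e2 * l1 ^ 3 * l2 ^ 3 / 36) := by
    simp [Emat, Matrix.det_succ_row_zero, Fin.sum_univ_succ, Fin.succAbove]
    ring
  refine hc.continuousAt.eventually_ne ?_
  rw [h0]
  exact neg_ne_zero.2 (by positivity)

/-- Body velocities without drag force that rotate the swimmer at fixed shape, respectively change
its shape, with their symmetries. -/
lemma exists_drag_free_velocities (hl1 : 0 < l1) (hl2 : 0 < l2) (hx1 : 0 < x1) (hx2 : 0 < x2)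
    (he1 : 0 < e1) (he2 : 0 < e2) (hne : (e1 - x1, e2 - x2) ≠ (0, 0)) (h1 : x1 ≤ e1)
    (h2 : x2 ≤ e2) :
    ∃ b₁ b₂ f₁ f₂ : ℝ → ℝ, ContDiff ℝ 1 b₁ ∧ ContDiff ℝ 1 b₂ ∧ ContDiff ℝ 1 f₁ ∧ ContDiff ℝ 1 f₂ ∧
      (∀ α, b₁ (-α) = -b₁ α) ∧ (∀ α, b₂ (-α) = b₂ α) ∧ (∀ α, f₁ (-α) = -f₁ α) ∧
      (∀ α, f₂ (-α) = f₂ α) ∧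
      (∀ α, ∃ p q, (Emat l1 l2 x1 x2 e1 e2 α).mulVec ![b₁ α, b₂ α, 1, 0] = ![0, 0, p, q]) ∧
      (∀ α, ∃ p q, (Emat l1 l2 x1 x2 e1 e2 α).mulVec ![f₁ α, f₂ α, 0, 1] = ![0, 0, p, q]) ∧
      deriv b₁ 0 + f₂ 0 ≠ 0 := by
  obtain ⟨c, hc⟩ : ∃ c, c = x1 * l1 + x2 * l2 := ⟨_, rfl⟩
  obtain ⟨d, hd⟩ : ∃ d, d = x1 * l1 + e2 * l2 := ⟨_, rfl⟩
  obtain ⟨g, hg⟩ : ∃ g, g = e1 * l1 + x2 * l2 := ⟨_, rfl⟩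
  obtain ⟨S, hS⟩ : ∃ S, S = e1 * l1 + e2 * l2 := ⟨_, rfl⟩
  have hc0 : 0 < c := by rw [hc]; positivity
  have hS0 : 0 < S := by rw [hS]; positivity
  have hD : ∀ α, dragDet c d g S α ≠ 0 := fun α =>
    (dragDet_pos hc0 (by rw [hd]; positivity) (by rw [hg]; positivity) hS0 α).ne'
  let β₁ : ℝ → ℝ := fun α => 1 / 2 * x1 * l1 * l2 * sin α
  let β₂ : ℝ → ℝ := fun α => 1 / 2 * e1 * l1 * (l1 + l2 * cos α)
  let γ₁ : ℝ → ℝ := fun _ => 0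
  let γ₂ : ℝ → ℝ := fun _ => 1 / 2 * e1 * l1 ^ 2
  have hβ₁ : ContDiff ℝ 1 β₁ := by fun_prop
  have hβ₂ : ContDiff ℝ 1 β₂ := by fun_prop
  have hγ₁ : ContDiff ℝ 1 γ₁ := contDiff_const
  have hγ₂ : ContDiff ℝ 1 γ₂ := contDiff_const
  have oβ : ∀ α, β₁ (-α) = -β₁ α := fun α => by simp [β₁]
  have eβ : ∀ α, β₂ (-α) = β₂ α := fun α => by simp [β₂]
  have oγ : ∀ α, γ₁ (-α) = -γ₁ α := fun α => by simp [γ₁]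
  have eγ : ∀ α, γ₂ (-α) = γ₂ α := fun α => rfl
  refine ⟨slide₁ c d g S β₁ β₂, slide₂ c d g S β₁ β₂, slide₁ c d g S γ₁ γ₂,
    slide₂ c d g S γ₁ γ₂, contDiff_slide₁ hD hβ₁ hβ₂, contDiff_slide₂ hD hβ₁ hβ₂,
    contDiff_slide₁ hD hγ₁ hγ₂, contDiff_slide₂ hD hγ₁ hγ₂, slide₁_neg oβ eβ, slide₂_neg oβ eβ,
    slide₁_neg oγ eγ, slide₂_neg oγ eγ, fun α => ?_, fun α => ?_, ?_⟩
  · rw [Emat_mulVec, ← hc, ← hd, ← hg, ← hS]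
    refine ⟨_, _, congrArg₂ Matrix.vecCons ?_ (congrArg₂ Matrix.vecCons ?_ rfl)⟩
    · linear_combination slide_balance₁ (β₁ := β₁) (β₂ := β₂) (hD α)
    · linear_combination slide_balance₂ (β₁ := β₁) (β₂ := β₂) (hD α)
  · rw [Emat_mulVec, ← hc, ← hd, ← hg, ← hS]
    refine ⟨_, _, congrArg₂ Matrix.vecCons ?_ (congrArg₂ Matrix.vecCons ?_ rfl)⟩
    · linear_combination slide_balance₁ (β₁ := γ₁) (β₂ := γ₂) (hD α)
    · linear_combination slide_balance₂ (β₁ := γ₁) (β₂ := γ₂) (hD α)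
  · have hμ : HasDerivAt β₁ (1 / 2 * x1 * l1 * l2) 0 := by
      exact ((hasDerivAt_sin 0).const_mul (1 / 2 * x1 * l1 * l2)).congr_deriv (by simp)
    rw [(hasDerivAt_slide₁_zero (hD 0) hμ (by simp [β₁])
      (hβ₂.differentiable (by norm_num) 0)).deriv]
    have hval : (S * (1 / 2 * x1 * l1 * l2) - d * β₂ 0) / (c * S) + slide₂ c d g S γ₁ γ₂ 0
        = -(l1 * l2 * (e2 * l2 * (e1 - x1) + e1 * l1 * (e2 - x2))) / (2 * c * S) := by
      simp only [slide₂, dragDet, β₂, γ₁, γ₂, sin_zero, cos_zero]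
      field_simp
      rw [hc, hd, hS]
      ring
    rw [hval]
    have hpos : 0 < e2 * l2 * (e1 - x1) + e1 * l1 * (e2 - x2) := by
      rcases h1.eq_or_lt with h | h
      · rcases h2.eq_or_lt with h' | h'
        · exact absurd (by simp [h, h']) hne
        · have := sub_pos.2 h'
          have := sub_nonneg.2 h1
          positivity
      · have := sub_pos.2 h
        have := sub_nonneg.2 h2
        positivity
    exact div_ne_zero (neg_ne_zero.2 (by positivity)) (by positivity)

end Drag

open Filter Topology in
/-- The swimmer can be steered between any two configurations close to a given straight one. -/
lemma eventually_steer_swimmer {l1 l2 x1 x2 e1 e2 k M1 M2 : ℝ}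
    (hl1 : 0 < l1) (hl2 : 0 < l2) (hx1 : 0 < x1) (hx2 : 0 < x2)
    (he1 : 0 < e1) (he2 : 0 < e2) (hk : 0 < k) (hA : AssumptionA l1 l2 x1 x2 e1 e2 M1 M2)
    {xe ye the : ℝ} {W : Set (Fin 4 → ℝ)} (hW : W ∈ 𝓝 ![xe, ye, the, 0])
    {T ε : ℝ} (hT : 0 < T) (hε : 0 < ε) :
    ∀ᶠ p : (Fin 4 → ℝ) × (Fin 4 → ℝ) in 𝓝 (![xe, ye, the, 0], ![xe, ye, the, 0]),
      Steer (fun z u w => F0 l1 l2 x1 x2 e1 e2 k z + u • F1 l1 l2 x1 x2 e1 e2 M1 z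
        + w • F2 l1 l2 x1 x2 e1 e2 M1 M2 z) W (2 * k * |(M2 + M1) / (M2 * M1)| + ε) ε T
        p.1 p.2 := by
  obtain ⟨hne, h1, h2, hM1, hM2, hA⟩ := hA
  obtain ⟨b₁, b₂, f₁, f₂, cb₁, cb₂, cf₁, cf₂, ob₁, eb₂, of₁, ef₂, hb, hf, hv⟩ :=
    exists_drag_free_velocities hl1 hl2 hx1 hx2 he1 he2 hne h1 h2
  choose pb qb hb using hb
  choose pf qf hf using hf
  have db₁ := cb₁.differentiable one_ne_zero
  have db₂ := cb₂.differentiable one_ne_zero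
  have df₁ := cf₁.differentiable one_ne_zero
  have df₂ := cf₂.differentiable one_ne_zero
  have hpb : pb = _ := funext fun α => (congrFun ((hb α).symm.trans (Emat_mulVec ..)) 2)
  have hqb : qb = _ := funext fun α => (congrFun ((hb α).symm.trans (Emat_mulVec ..)) 3)
  have hpf : pf = _ := funext fun α => (congrFun ((hf α).symm.trans (Emat_mulVec ..)) 2)
  have hqf : qf = _ := funext fun α => (congrFun ((hf α).symm.trans (Emat_mulVec ..)) 3)
  simp only [Matrix.cons_val] at hpb hqb hpf hqf
  have dpb : Differentiable ℝ pb := by rw [hpb]; fun_prop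
  have dqb : Differentiable ℝ qb := by rw [hqb]; fun_prop
  have dpf : Differentiable ℝ pf := by rw [hpf]; fun_prop
  have dqf : Differentiable ℝ qf := by rw [hqf]; fun_prop
  have hK : M2 * pb 0 - qb 0 * (M1 + M2) ≠ 0 := by
    have hb₂ : b₂ 0 = e1 * l1 * (l1 + l2) / (2 * (e1 * l1 + e2 * l2)) := by
      have := congrFun ((Emat_mulVec ..).symm.trans (hb 0)) 1
      simp at this
      field_simp
      linear_combination (-2) * this
    have hKA : M2 * pb 0 - qb 0 * (M1 + M2) =
        e1 * e2 * l1 ^ 2 * l2 ^ 2 / (12 * (e1 * l1 + e2 * l2)) *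
        ((3 + 4 * (l2 / l1) + e2 * l2 ^ 2 / (e1 * l1 ^ 2)) * M1
          - (3 + 4 * (l1 / l2) + e1 * l1 ^ 2 / (e2 * l2 ^ 2)) * M2) := by
      simp only [hpb, hqb, hb₂, sin_zero, cos_zero]
      field_simp
      ring
    rw [hKA]
    exact mul_ne_zero (by positivity) hA
  obtain ⟨r₀, hr₀⟩ : ∃ r₀, M2 * (pf 0 + r₀ * pb 0) - (qf 0 + r₀ * qb 0) * (M1 + M2) = 0 := by
    refine ⟨-(M2 * pf 0 - qf 0 * (M1 + M2)) / (M2 * pb 0 - qb 0 * (M1 + M2)), ?_⟩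
    generalize hx : -(M2 * pf 0 - qf 0 * (M1 + M2)) / (M2 * pb 0 - qb 0 * (M1 + M2)) = x
    rw [div_eq_iff hK] at hx
    linear_combination -hx
  let r : ℝ → ℝ := fun α => r₀ + 2 * α
  let Θ : ℝ → ℝ := fun α => r₀ * α + α ^ 2
  let a₁ : ℝ → ℝ := fun α => f₁ α + r α * b₁ α
  let a₂ : ℝ → ℝ := fun α => f₂ α + r α * b₂ α
  let q : ℝ → ℝ := fun α => qf α + r α * qb α
  let G : ℝ → ℝ := fun α => M2 * (pf α + r α * pb α) - q α * (M1 * cos α + M2)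
  have hr : Continuous r := by fun_prop
  have hΘ : ∀ α, HasDerivAt Θ (r α) α := fun α =>
    (((hasDerivAt_id α).const_mul r₀).add ((hasDerivAt_id α).pow 2)).congr_deriv (by simp [r])
  have cΘ : Continuous Θ := by fun_prop
  have ca₁ : Continuous a₁ := by fun_prop
  have ca₂ : Continuous a₂ := by fun_prop
  have dq : Differentiable ℝ q := by fun_prop
  have dG : Differentiable ℝ G := by fun_prop
  have cq := dq.continuous
  have cG := dG.continuous
  have hG0 : G 0 = 0 := by simpa [G, q, r] using hr₀
  have ha : ∀ α, (Emat l1 l2 x1 x2 e1 e2 α).mulVec ![a₁ α, a₂ α, r α, 1] =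
      ![0, 0, pf α + r α * pb α, q α] := by
    intro α
    have : ![a₁ α, a₂ α, r α, 1] = ![f₁ α, f₂ α, 0, 1] + r α • ![b₁ α, b₂ α, 1, 0] := by
      simp [a₁, a₂]
    rw [this, Matrix.mulVec_add, Matrix.mulVec_smul, hb, hf]
    simp [q]
  obtain ⟨σ, hσ, hbound⟩ := eventually_controls_lt hε hk hM1 hM2 (dG 0) hG0 cq.continuousAt
  have hev := hbound.and ((eventually_det_Emat_ne_zero hl1 hl2 hx1 hx2 he1 he2).and
    (continuous_abs.continuousAt.eventually (gt_mem_nhds (by simpa using pi_pos : |(0 : ℝ)| < π))))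
  obtain ⟨δ, hδ, hev⟩ := Metric.eventually_nhds_iff.1 hev
  simp only [dist_zero_right, Real.norm_eq_abs] at hev
  have hsin : ∀ {α}, |α| < δ → α ≠ 0 → sin α ≠ 0 := fun hα h0 h =>
    h0 ((sin_eq_zero_iff_of_lt_of_lt (abs_lt.1 (hev hα).2.2).1 (abs_lt.1 (hev hα).2.2).2).1 h)
  have hint : ∀ {F : ℝ → ℝ}, Continuous F → ∀ α, HasDerivAt (fun α => ∫ t in (0 : ℝ)..α, F t)
      (F α) α := fun hF α => (hF.integral_hasStrictDerivAt 0 α).hasDerivAt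
  have hP₁ := hint (F := fun α => cos (Θ α) * a₁ α - sin (Θ α) * a₂ α) (by fun_prop)
  have hP₂ := hint (F := fun α => sin (Θ α) * a₁ α + cos (Θ α) * a₂ α) (by fun_prop)
  refine eventually_steer (b₁ := b₁) (b₂ := b₂) hΘ hP₁ hP₂ (by simp [Θ])
    intervalIntegral.integral_same intervalIntegral.integral_same ca₁ ca₂ hr hδ hσ ?_ ?_ ?_ hW hT
  · intro s hs
    refine ⟨fun α => (s * G α + k * α * (M1 * cos α + M2)) / (M1 * M2 * sin α),
      fun α => (k * α - s * q α) / M2, ?_, ?_, fun α hα => ⟨((hev hα).1 s hs).1,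
      ((hev hα).1 s hs).2, fun z hz => ?_⟩⟩
    · exact Measurable.div (Continuous.measurable (by fun_prop)) (by fun_prop)
    · exact Continuous.measurable (by fun_prop)
    · subst hz
      refine controlled_field_eq_of_drag hM1 hM2 (hev hα).2.1 (ha _) ?_
      by_cases h0 : z 3 = 0
      · right
        rw [h0]
        exact ⟨rfl, hG0⟩
      · exact Or.inl (hsin hα h0)
  · intro α hα h0
    have hs0 := (hev hα).1 0 (by simpa using hσ)
    have hs : ∀ᶠ s in 𝓝 (0 : ℝ),
        |(s * (M2 * pb α - qb α * (M1 * cos α + M2)) + k * α * (M1 * cos α + M2))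
          / (M1 * M2 * sin α)| < 2 * k * |(M2 + M1) / (M2 * M1)| + ε ∧
        |(k * α - s * qb α) / M2| < ε := by
      refine (Tendsto.eventually (Continuous.continuousAt (by fun_prop)) (gt_mem_nhds ?_)).and
        (Tendsto.eventually (Continuous.continuousAt (by fun_prop)) (gt_mem_nhds ?_))
      · simpa using hs0.1
      · simpa using hs0.2
    obtain ⟨σ', hσ', hs⟩ := Metric.eventually_nhds_iff.1 hs
    simp only [dist_zero_right, Real.norm_eq_abs] at hs
    refine ⟨σ', hσ', fun s hsσ => ⟨_, _, (hs hsσ).1, (hs hsσ).2, fun z hz => ?_⟩⟩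
    subst hz
    exact controlled_field_eq_of_drag hM1 hM2 (hev hα).2.1 (hb _) (Or.inl (hsin hα h0))
  · have hb₁' : ∀ α, HasDerivAt b₁ (deriv b₁ α) α := fun α => (db₁ α).hasDerivAt
    have hb₂' : ∀ α, HasDerivAt b₂ (deriv b₂ α) α := fun α => (db₂ α).hasDerivAt
    refine exists_not_collinear (Θ := Θ) (v₁ := fun α => f₁ α - deriv b₂ α)
      (v₂ := fun α => deriv b₁ α + f₂ α) (fun α => ?_) (fun α => ?_) cΘ
      (cf₁.continuous.sub (cb₂.continuous_deriv le_rfl))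
      ((cb₁.continuous_deriv le_rfl).add cf₂.continuous) (by simp [Θ]) (fun α => ?_)
      (fun α => ?_) hv ?_
    · refine (((hP₁ α).sub ((hΘ α).cos.mul (hb₂' α))).sub
        ((hΘ α).sin.mul (hb₁' α))).congr_deriv ?_
      simp only [a₁, a₂]
      ring
    · refine (((hP₂ α).sub ((hΘ α).sin.mul (hb₂' α))).add
        ((hΘ α).cos.mul (hb₁' α))).congr_deriv ?_
      simp only [a₁, a₂]
      ring
    · have h := deriv_comp_neg b₂ α
      rw [funext eb₂] at h
      linarith [of₁ α]
    · have h := deriv_comp_neg b₁ α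
      rw [funext ob₁, deriv.fun_neg] at h
      linarith [ef₂ α]
    · refine Eventually.frequently ?_
      have h : ∀ᶠ α in 𝓝 (0 : ℝ), 2 * α ^ 2 < π := by
        have : Tendsto (fun α : ℝ => 2 * α ^ 2) (𝓝 0) (𝓝 0) :=
          Continuous.tendsto' (by fun_prop) _ _ (by simp)
        exact this.eventually (gt_mem_nhds pi_pos)
      filter_upwards [h.filter_mono nhdsWithin_le_nhds, self_mem_nhdsWithin] with α hα h0
      have e : Θ α + Θ (-α) = 2 * α ^ 2 := by simp only [Θ]; ring
      have h0 : α ≠ 0 := h0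
      rw [e]
      exact ne_of_gt (sin_pos_of_pos_of_lt_pi (by positivity) hα)

/-- Local controllability, Theorem 1 of the paper. -/
theorem stmt_6 (l1 l2 x1 x2 e1 e2 k M1 M2 : ℝ)
    (hl1 : 0 < l1) (hl2 : 0 < l2) (hx1 : 0 < x1) (hx2 : 0 < x2)
    (he1 : 0 < e1) (he2 : 0 < e2) (hk : 0 < k)
    (hA : AssumptionA l1 l2 x1 x2 e1 e2 M1 M2)
    (xe ye the : ℝ)
    (W : Set (Fin 4 → ℝ)) (hW : W ∈ nhds ![xe, ye, the, 0])
    (T ε : ℝ) (hT : 0 < T) (hε : 0 < ε) :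
    ∃ V ∈ nhds (![xe, ye, the, 0] : Fin 4 → ℝ), V ⊆ W ∧
      ∀ zi ∈ V, ∀ zf ∈ V,
        ∃ Hpar Hperp : ℝ → ℝ, Measurable Hpar ∧ Measurable Hperp ∧
          (∀ t ∈ Icc (0:ℝ) T, |Hperp t| < ε) ∧
          (∀ t ∈ Icc (0:ℝ) T, |Hpar t| < 2*k*|(M2 + M1)/(M2*M1)| + ε) ∧
          ∃ z : ℝ → Fin 4 → ℝ,
            ContinuousOn z (Icc 0 T) ∧ z 0 = zi ∧ z T = zf ∧
            (∀ t ∈ Icc (0:ℝ) T, z t ∈ W) ∧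
            ∀ t ∈ Icc (0:ℝ) T,
              z t = zi + ∫ s in (0:ℝ)..t,
                (F0 l1 l2 x1 x2 e1 e2 k (z s)
                  + Hpar s • F1 l1 l2 x1 x2 e1 e2 M1 (z s)
                  + Hperp s • F2 l1 l2 x1 x2 e1 e2 M1 M2 (z s)) := by
  have key := eventually_steer_swimmer hl1 hl2 hx1 hx2 he1 he2 hk hA hW hT hε
  rw [nhds_prod_eq, Filter.eventually_prod_self_iff] at key
  obtain ⟨V, hV, hsteer⟩ := key
  refine ⟨V ∩ W, Filter.inter_mem hV hW, inter_subset_right, fun zi hzi zf hzf => ?_⟩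
  exact Steer.exists_integral_eq (hsteer zi hzi.1 zf hzf.1)
end

section
/- (Invariance of the dynamics.) Let t ↦ z(t) = (x(t), y(t), θ(t), α(t)) be a differentiable solution on an interval of ż = F0(z) + H∥(t) F1(z) + H⊥(t) F2(z) for some measurable controls H∥, H⊥. Then for any constants x̄, ȳ, θ̄ ∈ ℝ, the function t ↦ (R_{θ̄}·(x(t)+x̄, y(t)+ȳ), θ(t)+θ̄, α(t)), where R_{θ̄} is the 2×2 rotation matrix of angle θ̄, is also a solution of the same ODE with the same controls H∥, H⊥. -/
open Real Matrix Set

theorem Rtil_add (a b : ℝ) : Rtil (a + b) = Rtil b * Rtil a := by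
  ext i j
  fin_cases i <;> fin_cases j <;>
    simp [Rtil, Matrix.mul_apply, Fin.sum_univ_four, Real.cos_add, Real.sin_add] <;> ring

section Equivariance

variable {l1 l2 x1 x2 e1 e2 b : ℝ} {z w : Fin 4 → ℝ}

theorem X3_of_rotated (h2 : w 2 = z 2 + b) (h3 : w 3 = z 3) :
    X3 l1 l2 x1 x2 e1 e2 w = (Rtil b).mulVec (X3 l1 l2 x1 x2 e1 e2 z) := by
  simp only [X3, h2, h3, Rtil_add, Matrix.mulVec_mulVec]

theorem X4_of_rotated (h2 : w 2 = z 2 + b) (h3 : w 3 = z 3) :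
    X4 l1 l2 x1 x2 e1 e2 w = (Rtil b).mulVec (X4 l1 l2 x1 x2 e1 e2 z) := by
  simp only [X4, h2, h3, Rtil_add, Matrix.mulVec_mulVec]

/-- The controlled vector field is equivariant under rotations and does not depend on position. -/
theorem controlled_field_of_rotated (k M1 M2 u v : ℝ) (h2 : w 2 = z 2 + b) (h3 : w 3 = z 3) :
    F0 l1 l2 x1 x2 e1 e2 k w + u • F1 l1 l2 x1 x2 e1 e2 M1 w
        + v • F2 l1 l2 x1 x2 e1 e2 M1 M2 w
      = (Rtil b).mulVec (F0 l1 l2 x1 x2 e1 e2 k z + u • F1 l1 l2 x1 x2 e1 e2 M1 z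
        + v • F2 l1 l2 x1 x2 e1 e2 M1 M2 z) := by
  simp only [F0, F1, F2, X3_of_rotated h2 h3, X4_of_rotated h2 h3, h3, Matrix.mulVec_add,
    Matrix.mulVec_sub, Matrix.mulVec_smul]

end Equivariance

theorem Rtil_mulVec_add_translation (b xb yb : ℝ) (v : Fin 4 → ℝ) :
    (Rtil b).mulVec (v + ![xb, yb, b, 0]) =
      ![Real.cos b * (v 0 + xb) - Real.sin b * (v 1 + yb),
        Real.sin b * (v 0 + xb) + Real.cos b * (v 1 + yb), v 2 + b, v 3] := by
  ext i
  fin_cases i <;> simp [Rtil, Matrix.mulVec, dotProduct, Fin.sum_univ_four]; ring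

/-- Invariance: translations and rotations map solutions to solutions. -/
theorem stmt_7 (l1 l2 x1 x2 e1 e2 k M1 M2 : ℝ)
    (hl1 : 0 < l1) (hl2 : 0 < l2) (hx1 : 0 < x1) (hx2 : 0 < x2)
    (he1 : 0 < e1) (he2 : 0 < e2) (hk : 0 < k)
    (I : Set ℝ) (hI : I.OrdConnected)
    (Hpar Hperp : ℝ → ℝ) (hHpar : Measurable Hpar) (hHperp : Measurable Hperp)
    (z : ℝ → Fin 4 → ℝ)
    (hz : ∀ t ∈ I, HasDerivWithinAt z
      (F0 l1 l2 x1 x2 e1 e2 k (z t) + Hpar t • F1 l1 l2 x1 x2 e1 e2 M1 (z t)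
        + Hperp t • F2 l1 l2 x1 x2 e1 e2 M1 M2 (z t)) I t)
    (xb yb tb : ℝ) :
    ∀ t ∈ I, HasDerivWithinAt
      (fun s => (![Real.cos tb * (z s 0 + xb) - Real.sin tb * (z s 1 + yb),
                   Real.sin tb * (z s 0 + xb) + Real.cos tb * (z s 1 + yb),
                   z s 2 + tb, z s 3] : Fin 4 → ℝ))
      (F0 l1 l2 x1 x2 e1 e2 k
          ![Real.cos tb * (z t 0 + xb) - Real.sin tb * (z t 1 + yb),
            Real.sin tb * (z t 0 + xb) + Real.cos tb * (z t 1 + yb),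
            z t 2 + tb, z t 3]
        + Hpar t • F1 l1 l2 x1 x2 e1 e2 M1
          ![Real.cos tb * (z t 0 + xb) - Real.sin tb * (z t 1 + yb),
            Real.sin tb * (z t 0 + xb) + Real.cos tb * (z t 1 + yb),
            z t 2 + tb, z t 3]
        + Hperp t • F2 l1 l2 x1 x2 e1 e2 M1 M2
          ![Real.cos tb * (z t 0 + xb) - Real.sin tb * (z t 1 + yb),
            Real.sin tb * (z t 0 + xb) + Real.cos tb * (z t 1 + yb),
            z t 2 + tb, z t 3]) I t := by
  intro t ht
  rw [controlled_field_of_rotated (z := z t) (w := ![_, _, z t 2 + tb, z t 3]) k M1 M2 _ _ rfl rfl]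
  simp only [← Rtil_mulVec_add_translation]
  exact (Rtil tb).mulVecLin.toContinuousLinearMap.hasFDerivAt.comp_hasDerivWithinAt t
    ((hz t ht).add_const _)
end

section
/- Let A be the 4×4 Jacobian matrix of the map z ↦ F0(z) at the point O = (0,0,0,0), and let B be the 4×2 matrix whose columns are F1(O) and F2(O). Then the 4×8 controllability matrix C = [B, AB, A²B, A³B] has rank at most 2. In particular, the linearized control system at the equilibrium O is not controllable. -/
open Real Matrix Set

/-- If both `A` and `B` have rank at most one, then the controllability matrix
`[B, AB, A²B, …]` has rank at most two. -/
theorem rank_controllability_le_two {ι κ : Type*} [Fintype ι] [DecidableEq ι] [Fintype κ]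
    (n : ℕ) (v w b : ι → ℝ) (c : κ → ℝ) :
    (Matrix.of fun i (p : Fin n × κ) =>
      (vecMulVec v w ^ (p.1 : ℕ) * vecMulVec b c) i p.2).rank ≤ 2 := by
  have hC : (Matrix.of fun i (p : Fin n × κ) =>
      (vecMulVec v w ^ (p.1 : ℕ) * vecMulVec b c) i p.2) =
      (Matrix.of ![v, b])ᵀ * Matrix.of ![
        fun p : Fin n × κ => if (p.1 : ℕ) = 0 then 0 else
          (w ᵥ* (vecMulVec v w ^ ((p.1 : ℕ) - 1) * vecMulVec b c)) p.2,
        fun p : Fin n × κ => if (p.1 : ℕ) = 0 then c p.2 else 0] := by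
    ext i ⟨⟨m, hm⟩, q⟩
    cases m with
    | zero =>
      rw [of_apply, pow_zero, Matrix.one_mul, vecMulVec_apply]
      simp [Matrix.mul_apply]
    | succ m =>
      rw [of_apply, pow_succ', Matrix.mul_assoc, vecMulVec_mul, vecMulVec_apply]
      simp [Matrix.mul_apply]
  rw [hC]
  exact (rank_mul_le_left _ _).trans (rank_le_card_width _)

/-- A derivative vanishes in a direction along which the function vanishes. -/
theorem fderiv_apply_eq_zero_of_forall_add_smul {E F : Type*} [NormedAddCommGroup E]
    [NormedSpace ℝ E] [NormedAddCommGroup F] [NormedSpace ℝ F] {f : E → F} {x v : E}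
    (h : ∀ t : ℝ, f (x + t • v) = 0) : fderiv ℝ f x v = 0 := by
  by_cases hf : DifferentiableAt ℝ f x
  · rw [← hf.lineDeriv_eq_fderiv]
    simp [lineDeriv, h]
  · simp [fderiv_zero_of_not_differentiableAt hf]

/-- `F0` vanishes on the hyperplane `α = 0`, so its Jacobian at the origin has only its last
column nonzero. -/
theorem fderiv_F0_Ovec_single (l1 l2 x1 x2 e1 e2 k : ℝ) {j : Fin 4} (hj : j ≠ 3) :
    fderiv ℝ (F0 l1 l2 x1 x2 e1 e2 k) Ovec (Pi.single j 1) = 0 :=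
  fderiv_apply_eq_zero_of_forall_add_smul fun t => by
    simp [F0, Ovec, Pi.single_eq_of_ne hj.symm]

/-- the Kalman controllability matrix of the linearization at O has rank ≤ 2. -/
theorem stmt_8 (l1 l2 x1 x2 e1 e2 k M1 M2 : ℝ)
    (hl1 : 0 < l1) (hl2 : 0 < l2) (hx1 : 0 < x1) (hx2 : 0 < x2)
    (he1 : 0 < e1) (he2 : 0 < e2) (hk : 0 < k) :
    let A : Matrix (Fin 4) (Fin 4) ℝ :=
      Matrix.of fun i j => fderiv ℝ (F0 l1 l2 x1 x2 e1 e2 k) Ovec (Pi.single j 1) i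
    let B : Matrix (Fin 4) (Fin 2) ℝ :=
      Matrix.of fun i j =>
        ![F1 l1 l2 x1 x2 e1 e2 M1 Ovec, F2 l1 l2 x1 x2 e1 e2 M1 M2 Ovec] j i
    let C : Matrix (Fin 4) (Fin 4 × Fin 2) ℝ :=
      Matrix.of fun i p => ((A ^ (p.1 : ℕ)) * B) i p.2
    C.rank ≤ 2 := by
  intro A B C
  have hA : A = vecMulVec (fun i => A i 3) (Pi.single 3 1) := by
    ext i j
    by_cases hj : j = 3
    · simp [vecMulVec_apply, hj]
    · simp [vecMulVec_apply, hj, A, fderiv_F0_Ovec_single]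
  have hB : B = vecMulVec (F2 l1 l2 x1 x2 e1 e2 M1 M2 Ovec) ![0, 1] := by
    ext i j
    fin_cases j
    · simp [vecMulVec_apply, B, F1, Ovec]
    · simp [vecMulVec_apply, B]
  change (Matrix.of fun i (p : Fin 4 × Fin 2) => (A ^ (p.1 : ℕ) * B) i p.2).rank ≤ 2
  rw [hB, hA]
  exact rank_controllability_le_two 4 _ _ _ _
end

section
/- (LARC at the origin.) Let Assumption A hold. Then the five vectors [F0,F2](O), [F1,F2](O), [F2,[F1,F2]](O), ([F1,[F2,[F2,[F1,F2]]]] − [F2,[F1,[F2,[F1,F2]]]])(O), and ([F0,[F2,[F2,[F1,F2]]]] − [F2,[F0,[F2,[F1,F2]]]])(O) span ℝ⁴, where O = (0,0,0,0). In particular, the Lie algebra rank condition for the system ż = F0(z) + H∥ F1(z) + H⊥ F2(z) is satisfied at O. -/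
open Real Matrix Set

open VectorField in
lemma lieBr_eq_lieBracket : lieBr = lieBracket ℝ := rfl

/-- The planar rotation generator acting on the first two coordinates. -/
def quarterTurn (w : Fin 4 → ℝ) : Fin 4 → ℝ := ![-w 1, w 0, 0, 0]

/-- The vector field on ℝ⁴ obtained by rotating a curve in the shape variable α. -/
noncomputable def rotLift (u : ℝ → Fin 4 → ℝ) (z : Fin 4 → ℝ) : Fin 4 → ℝ :=
  (Rtil (z 2)).mulVec (u (z 3))

/-- The bracket on curves corresponding to the Lie bracket of their rotated lifts. -/
noncomputable def curveBr (u v : ℝ → Fin 4 → ℝ) (s : ℝ) : Fin 4 → ℝ :=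
  u s 3 • deriv v s - v s 3 • deriv u s
    + (u s 2 • quarterTurn (v s) - v s 2 • quarterTurn (u s))

lemma curveBr_apply (u v : ℝ → Fin 4 → ℝ) (s : ℝ) (i : Fin 4) :
    curveBr u v s i = u s 3 * deriv v s i - v s 3 * deriv u s i
      + (u s 2 * quarterTurn (v s) i - v s 2 * quarterTurn (u s) i) := rfl

lemma rotLift_eq (u : ℝ → Fin 4 → ℝ) (z : Fin 4 → ℝ) :
    rotLift u z = ![cos (z 2) * u (z 3) 0 - sin (z 2) * u (z 3) 1,
      sin (z 2) * u (z 3) 0 + cos (z 2) * u (z 3) 1, u (z 3) 2, u (z 3) 3] := by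
  ext i
  fin_cases i <;>
    simp [rotLift, Rtil, Matrix.mulVec, dotProduct, Fin.sum_univ_four, sub_eq_add_neg]

lemma rotLift_Ovec (u : ℝ → Fin 4 → ℝ) : rotLift u Ovec = u 0 := by
  ext i
  rw [rotLift_eq]
  fin_cases i <;> simp [Ovec]

lemma ContDiff.rotLift {n : WithTop ℕ∞} {u : ℝ → Fin 4 → ℝ} (hu : ContDiff ℝ n u) :
    ContDiff ℝ n (rotLift u) := by
  have h : ∀ i, ContDiff ℝ n fun z : Fin 4 → ℝ => u (z 3) i := fun i =>
    (contDiff_pi.1 hu i).comp (contDiff_apply ℝ ℝ 3)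
  have h2 : ContDiff ℝ n fun z : Fin 4 → ℝ => z 2 := contDiff_apply ℝ ℝ 2
  rw [funext (rotLift_eq u), contDiff_pi]
  intro i
  fin_cases i
  · exact (h2.cos.mul (h 0)).sub (h2.sin.mul (h 1))
  · exact (h2.sin.mul (h 0)).add (h2.cos.mul (h 1))
  · exact h 2
  · exact h 3

lemma fderiv_rotLift {u : ℝ → Fin 4 → ℝ} (hu : ContDiff ℝ 1 u) (z w : Fin 4 → ℝ) :
    fderiv ℝ (rotLift u) z w =
      (Rtil (z 2)).mulVec (w 3 • deriv u (z 3) + w 2 • quarterTurn (u (z 3))) := by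
  have hd : DifferentiableAt ℝ (rotLift u) z := hu.rotLift.differentiable one_ne_zero z
  rw [← hd.lineDeriv_eq_fderiv, lineDeriv]
  have hl : ∀ i, HasDerivAt (fun t : ℝ => (z + t • w) i) (w i) 0 := fun i => by
    simpa using ((hasDerivAt_id (0 : ℝ)).mul_const (w i)).const_add (z i)
  have hui : ∀ i, HasDerivAt (fun t : ℝ => u ((z + t • w) 3) i) (deriv u (z 3) i * w 3) 0 := by
    intro i
    have h := hasDerivAt_pi.1 (hu.differentiable one_ne_zero (z 3)).hasDerivAt i
    have h' : HasDerivAt (fun x => u x i) (deriv u (z 3) i) ((z + (0 : ℝ) • w) 3) := by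
      simpa using h
    exact h'.comp 0 (hl 3)
  refine HasDerivAt.deriv ?_
  rw [show (fun t : ℝ => rotLift u (z + t • w)) = _ from funext fun t => rotLift_eq u _,
    hasDerivAt_pi]
  intro i
  fin_cases i
  · refine (((hl 2).cos.mul (hui 0)).sub ((hl 2).sin.mul (hui 1))).congr_deriv ?_
    simp [Rtil, Matrix.mulVec, dotProduct, Fin.sum_univ_four, quarterTurn]
    ring
  · refine (((hl 2).sin.mul (hui 0)).add ((hl 2).cos.mul (hui 1))).congr_deriv ?_
    simp [Rtil, Matrix.mulVec, dotProduct, Fin.sum_univ_four, quarterTurn]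
    ring
  · refine (hui 2).congr_deriv ?_
    simp [Rtil, Matrix.mulVec, dotProduct, Fin.sum_univ_four, quarterTurn]
    ring
  · refine (hui 3).congr_deriv ?_
    simp [Rtil, Matrix.mulVec, dotProduct, Fin.sum_univ_four, quarterTurn]
    ring

lemma lieBr_rotLift {u v : ℝ → Fin 4 → ℝ} (hu : ContDiff ℝ 1 u) (hv : ContDiff ℝ 1 v) :
    lieBr (rotLift u) (rotLift v) = rotLift (curveBr u v) := by
  ext1 z
  have h2 : ∀ u : ℝ → Fin 4 → ℝ, rotLift u z 2 = u (z 3) 2 := fun u => by simp [rotLift_eq]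
  have h3 : ∀ u : ℝ → Fin 4 → ℝ, rotLift u z 3 = u (z 3) 3 := fun u => by simp [rotLift_eq]
  rw [lieBr, fderiv_rotLift hu, fderiv_rotLift hv, ← Matrix.mulVec_sub, h2, h2, h3, h3, rotLift]
  congr 1
  rw [curveBr]
  abel

open scoped ContDiff in
lemma ContDiff.curveBr {u v : ℝ → Fin 4 → ℝ} (hu : ContDiff ℝ ∞ u) (hv : ContDiff ℝ ∞ v) :
    ContDiff ℝ ∞ (curveBr u v) := by
  have hd : ∀ {w : ℝ → Fin 4 → ℝ}, ContDiff ℝ ∞ w → ContDiff ℝ ∞ (deriv w) := fun h =>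
    (contDiff_infty_iff_deriv.1 h).2
  have hq : ∀ {w : ℝ → Fin 4 → ℝ}, ContDiff ℝ ∞ w → ContDiff ℝ ∞ fun s => quarterTurn (w s) := by
    intro w h
    have h' := contDiff_pi.1 h
    rw [contDiff_pi]
    intro i
    fin_cases i
    · exact (h' 1).neg
    · exact h' 0
    · exact contDiff_const
    · exact contDiff_const
  have hu' := contDiff_pi.1 hu
  have hv' := contDiff_pi.1 hv
  exact (((hu' 3).smul (hd hv)).sub ((hv' 3).smul (hd hu))).add
    (((hu' 2).smul (hq hv)).sub ((hv' 2).smul (hq hu)))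

lemma lieBr_sub_lieBr_eq {U V W : (Fin 4 → ℝ) → Fin 4 → ℝ} {z : Fin 4 → ℝ}
    (hU : ContDiffAt ℝ 2 U z) (hV : ContDiffAt ℝ 2 V z) (hW : ContDiffAt ℝ 2 W z) :
    lieBr U (lieBr V W) z - lieBr V (lieBr U W) z = lieBr (lieBr U V) W z := by
  rw [lieBr_eq_lieBracket,
    VectorField.leibniz_identity_lieBracket (n := 2) (by simp) hU hV hW, add_sub_cancel_right]

lemma span_eq_top_of_mem {S : Submodule ℝ (Fin 4 → ℝ)} {a b Z : Fin 4 → ℝ} {r : ℝ}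
    (hr : r ≠ 0) (hΔ : a 2 * b 3 - a 3 * b 2 ≠ 0) (ha : a ∈ S) (hb : b ∈ S)
    (he : Pi.single 0 1 ∈ S)
    (haZ : a 3 • Z + (a 2 * r) • Pi.single 1 1 ∈ S)
    (hbZ : b 3 • Z + (b 2 * r) • Pi.single 1 1 ∈ S) : S = ⊤ := by
  have h1 : (Pi.single 1 1 : Fin 4 → ℝ) ∈ S := by
    refine (S.smul_mem_iff (mul_ne_zero hΔ hr)).1 ?_
    convert S.sub_mem (S.smul_mem (b 3) haZ) (S.smul_mem (a 3) hbZ) using 1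
    module
  have h2 : (Pi.single 2 1 : Fin 4 → ℝ) ∈ S := by
    refine (S.smul_mem_iff hΔ).1 ?_
    convert S.sub_mem (S.sub_mem (S.sub_mem (S.smul_mem (b 3) ha) (S.smul_mem (a 3) hb))
      (S.smul_mem (b 3 * a 0 - a 3 * b 0) he)) (S.smul_mem (b 3 * a 1 - a 3 * b 1) h1) using 1
    ext i; fin_cases i <;> simp <;> ring
  have h3 : (Pi.single 3 1 : Fin 4 → ℝ) ∈ S := by
    refine (S.smul_mem_iff hΔ).1 ?_
    convert S.sub_mem (S.sub_mem (S.sub_mem (S.smul_mem (a 2) hb) (S.smul_mem (b 2) ha))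
      (S.smul_mem (a 2 * b 0 - b 2 * a 0) he)) (S.smul_mem (a 2 * b 1 - b 2 * a 1) h1) using 1
    ext i; fin_cases i <;> simp <;> ring
  rw [eq_top_iff]
  intro v _
  rw [pi_eq_sum_univ' v]
  refine S.sum_mem fun i _ => S.smul_mem _ ?_
  fin_cases i
  exacts [he, h1, h2, h3]

section Brackets

open scoped ContDiff

variable {a b : ℝ → Fin 4 → ℝ}

lemma curveBr_sin_smul (ha : Differentiable ℝ a) (hb : Differentiable ℝ b) (M1 M2 : ℝ) :
    curveBr (fun s => (M1 * sin s) • a s)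
        (fun s => (-(M1 * cos s + M2)) • a s - M2 • b s) =
      fun s => (-(M1 * M2 * sin s)) • curveBr a b s
        + (M1 ^ 2 * a s 3 + M1 * M2 * cos s * (a s 3 + b s 3)) • a s := by
  ext s i
  have h1 : HasDerivAt (fun s => (M1 * sin s) • a s)
      ((M1 * sin s) • deriv a s + (M1 * cos s) • a s) s :=
    ((hasDerivAt_sin s).const_mul M1).smul (ha s).hasDerivAt
  have h2 : HasDerivAt (fun s => (-(M1 * cos s + M2)) • a s - M2 • b s)
      ((-(M1 * cos s + M2)) • deriv a s + (-(M1 * -sin s)) • a s - M2 • deriv b s) s :=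
    ((((hasDerivAt_cos s).const_mul M1).add_const M2).neg.smul (ha s).hasDerivAt).sub
      ((hb s).hasDerivAt.const_smul M2)
  simp only [Pi.add_apply, Pi.smul_apply, smul_eq_mul, curveBr_apply, h1.deriv, h2.deriv]
  fin_cases i <;> simp [quarterTurn]
  · linear_combination (M1 ^ 2 * a s 3 * a s 0) * sin_sq_add_cos_sq s
  · linear_combination (M1 ^ 2 * a s 3 * a s 1) * sin_sq_add_cos_sq s
  · linear_combination (M1 ^ 2 * a s 3 * a s 2) * sin_sq_add_cos_sq s
  · linear_combination (M1 ^ 2 * a s 3 * a s 3) * sin_sq_add_cos_sq s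

lemma curveBr_id_smul_zero (hb : Differentiable ℝ b) (k : ℝ)
    (g : ℝ → Fin 4 → ℝ) :
    curveBr (fun s => (k * s) • b s) g 0 = (-(k * g 0 3)) • b 0 := by
  have h1 : HasDerivAt (fun s => (k * s) • b s)
      ((k * 0) • deriv b 0 + (k * 1) • b 0) 0 :=
    ((hasDerivAt_id (0 : ℝ)).const_mul k).smul (hb 0).hasDerivAt
  ext i
  simp only [curveBr_apply, h1.deriv]
  fin_cases i <;> simp [quarterTurn] <;> ring

lemma span_brackets_eq_top (ha : ContDiff ℝ ∞ a) (hb : ContDiff ℝ ∞ b)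
    (ha0 : a 0 0 = 0) (hb0 : b 0 0 = 0)
    (ha' : ∀ i ≠ 0, deriv a 0 i = 0) (hb' : ∀ i ≠ 0, deriv b 0 i = 0)
    (hΔ : a 0 2 * b 0 3 - a 0 3 * b 0 2 ≠ 0) (hq : curveBr a b 0 0 ≠ 0)
    {k M1 M2 : ℝ} (hk : k ≠ 0) (hM1 : M1 ≠ 0) (hM2 : M2 ≠ 0)
    (hg : (M1 + M2) * a 0 3 + M2 * b 0 3 ≠ 0)
    {G0 G1 G2 : (Fin 4 → ℝ) → Fin 4 → ℝ}
    (hG0 : G0 = rotLift fun s => (k * s) • b s)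
    (hG1 : G1 = rotLift fun s => (M1 * sin s) • a s)
    (hG2 : G2 = rotLift fun s => (-(M1 * cos s + M2)) • a s - M2 • b s) :
    Submodule.span ℝ
      ({lieBr G0 G2 Ovec,
        lieBr G1 G2 Ovec,
        lieBr G2 (lieBr G1 G2) Ovec,
        lieBr G1 (lieBr G2 (lieBr G2 (lieBr G1 G2))) Ovec
          - lieBr G2 (lieBr G1 (lieBr G2 (lieBr G1 G2))) Ovec,
        lieBr G0 (lieBr G2 (lieBr G2 (lieBr G1 G2))) Ovec
          - lieBr G2 (lieBr G0 (lieBr G2 (lieBr G1 G2))) Ovec} :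
        Set (Fin 4 → ℝ)) = ⊤ := by
  have hda : Differentiable ℝ a := ha.differentiable (by simp)
  have hdb : Differentiable ℝ b := hb.differentiable (by simp)
  set g0 : ℝ → Fin 4 → ℝ := fun s => (k * s) • b s with hg0
  set g1 : ℝ → Fin 4 → ℝ := fun s => (M1 * sin s) • a s
  set g2 : ℝ → Fin 4 → ℝ := fun s => (-(M1 * cos s + M2)) • a s - M2 • b s with hg2
  set g : ℝ := (M1 + M2) * a 0 3 + M2 * b 0 3 with hgdef
  have c0 : ContDiff ℝ ∞ g0 := (contDiff_const.mul contDiff_id).smul hb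
  have c1 : ContDiff ℝ ∞ g1 := (contDiff_const.mul contDiff_sin).smul ha
  have c2 : ContDiff ℝ ∞ g2 :=
    ((contDiff_const.mul contDiff_cos).add contDiff_const).neg.smul ha |>.sub
      (hb.const_smul M2)
  have lift : ∀ {u v : ℝ → Fin 4 → ℝ}, ContDiff ℝ ∞ u → ContDiff ℝ ∞ v →
      lieBr (rotLift u) (rotLift v) = rotLift (curveBr u v) := fun hu hv =>
    lieBr_rotLift (hu.of_le (by simp)) (hv.of_le (by simp))
  have smooth : ∀ {u : ℝ → Fin 4 → ℝ}, ContDiff ℝ ∞ u → ContDiffAt ℝ 2 (rotLift u) Ovec :=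
    fun hu => (contDiff_infty.1 hu.rotLift 2).contDiffAt
  have cp := c1.curveBr c2
  have cY := c2.curveBr cp
  rw [hG0, hG1, hG2, lift c0 c2, lift c1 c2, lift c2 cp,
    lieBr_sub_lieBr_eq (smooth c1) (smooth c2) (smooth cY),
    lieBr_sub_lieBr_eq (smooth c0) (smooth c2) (smooth cY),
    lift c0 c2, lift c1 c2, lift cp cY, lift (c0.curveBr c2) cY]
  simp only [rotLift_Ovec]
  have hg20 : g2 0 = (-(M1 + M2)) • a 0 - M2 • b 0 := by simp [hg2]
  have hg203 : g2 0 3 = -g := by simp [hg20, hgdef]; ring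
  have hp0' : curveBr g0 g2 0 = (k * g) • b 0 := by
    rw [hg0, curveBr_id_smul_zero hdb, hg203]; congr 1; ring
  have hp := curveBr_sin_smul hda hdb M1 M2
  have hp0 : curveBr g1 g2 0 = (M1 * g) • a 0 := by
    rw [hp]; simp only [sin_zero, cos_zero, hgdef]; module
  have hg2' : deriv g2 0 = (-(M1 + M2)) • deriv a 0 - M2 • deriv b 0 := by
    refine HasDerivAt.deriv ?_
    refine (((((hasDerivAt_cos 0).const_mul M1).add_const M2).neg.smul (hda 0).hasDerivAt).sub
      ((hdb 0).hasDerivAt.const_smul M2)).congr_deriv ?_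
    simp
  have hp' : deriv (curveBr g1 g2) 0 = (-(M1 * M2)) • curveBr a b 0 + (M1 * g) • deriv a 0 := by
    refine HasDerivAt.deriv ?_
    have hq' := ((ha.curveBr hb).differentiable (by simp) 0).hasDerivAt
    have ha3 := hasDerivAt_pi.1 (hda 0).hasDerivAt 3
    have hb3 := hasDerivAt_pi.1 (hdb 0).hasDerivAt 3
    rw [ha' 3 (by decide)] at ha3
    rw [hb' 3 (by decide)] at hb3
    rw [hp]
    refine ((((hasDerivAt_sin 0).const_mul (M1 * M2)).neg.smul hq').add
      (((ha3.const_mul (M1 ^ 2)).add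
        (((hasDerivAt_cos 0).const_mul (M1 * M2)).mul (ha3.add hb3))).smul
          (hda 0).hasDerivAt)).congr_deriv ?_
    simp only [Pi.neg_apply, Pi.add_apply, Pi.mul_apply, sin_zero, cos_zero, hgdef]
    module
  have hqi : ∀ i ≠ 0, curveBr a b 0 i = 0 := by
    intro i hi
    simp only [curveBr_apply, ha' i hi, hb' i hi]
    fin_cases i <;> simp_all [quarterTurn]
  have hY0 : curveBr g2 (curveBr g1 g2) 0 = (2 * g * M1 * M2 * curveBr a b 0 0) • Pi.single 0 1 := by
    ext i
    rw [curveBr_apply, hp', hp0, hg2', hg20]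
    fin_cases i
    · simp [quarterTurn, curveBr_apply, ha0, hb0, hgdef]
      ring
    all_goals simp [quarterTurn, ha', hb', hqi, ha0, hb0]
  set Y := curveBr g2 (curveBr g1 g2)
  set r : ℝ := 2 * g * M1 * M2 * curveBr a b 0 0 with hr
  have hr0 : r ≠ 0 := by
    simp only [hr]
    exact mul_ne_zero (mul_ne_zero (mul_ne_zero (mul_ne_zero two_ne_zero hg) hM1) hM2) hq
  have hend : ∀ (u : ℝ → Fin 4 → ℝ) (m : ℝ) (w : Fin 4 → ℝ), u 0 = m • w →
      curveBr u Y 0 = m • (w 3 • deriv Y 0 + (w 2 * r) • Pi.single 1 1) := by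
    intro u m w hu
    ext i
    rw [curveBr_apply, hY0, hu]
    fin_cases i <;> simp [quarterTurn] <;> ring
  rw [hend _ _ _ hp0, hend _ _ _ hp0', hp0, hp0', hY0]
  refine span_eq_top_of_mem (Z := deriv Y 0) hr0 hΔ ?_ ?_ ?_ ?_ ?_
  · exact (Submodule.smul_mem_iff _ (mul_ne_zero hM1 hg)).1 (Submodule.subset_span (by simp))
  · exact (Submodule.smul_mem_iff _ (mul_ne_zero hk hg)).1 (Submodule.subset_span (by simp))
  · exact (Submodule.smul_mem_iff _ hr0).1 (Submodule.subset_span (by simp))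
  · exact (Submodule.smul_mem_iff _ (mul_ne_zero hM1 hg)).1 (Submodule.subset_span (by simp))
  · exact (Submodule.smul_mem_iff _ (mul_ne_zero hk hg)).1 (Submodule.subset_span (by simp))

end Brackets

lemma deriv_zero_of_even {f : ℝ → ℝ} (hf : ∀ s, f (-s) = f s) : deriv f 0 = 0 := by
  have h := deriv_comp_neg f 0
  rw [funext hf, neg_zero] at h
  linarith

section Columns

open scoped ContDiff

variable {l1 l2 x1 x2 e1 e2 : ℝ}

/-- The α-dependent factor of the determinant of `Emat`. -/
noncomputable def detFactor (l1 l2 x1 x2 e1 e2 s : ℝ) : ℝ :=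
  4 * (x1 * l1 + x2 * l2) * (e1 * l1 + e2 * l2) * cos s ^ 2
    + (4 * x1 * l1 + e2 * l2) * (e1 * l1 + 4 * x2 * l2) * sin s ^ 2

/-- The quotient by `sin s` of the first coordinate of `dragCol`. -/
noncomputable def dragColFst (l1 l2 x1 x2 e1 e2 d y0 s : ℝ) : ℝ :=
  36 / (l1 * l2 * detFactor l1 l2 x1 x2 e1 e2 s) *
    (l2 * (4 * x1 * l1 + e2 * l2) / 6
        * (d + (e2 * l2 ^ 2 / 2 + cos s * l1 * (e1 * l1 / 6 + 2 * e2 * l2 / 3)) * y0)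
      - (x1 * l1 + e2 * l2) * (e1 * l1 + e2 * l2) * l1 * l2 * cos s / 9 * y0)

/-- The third coordinate of `dragCol`. -/
noncomputable def dragColAngle (l1 l2 x1 x2 e1 e2 d y0 s : ℝ) : ℝ :=
  36 / (l1 * l2 * detFactor l1 l2 x1 x2 e1 e2 s) *
    ((x1 * l1 + x2 * l2) * cos s
        * (d + (e2 * l2 ^ 2 / 2 + cos s * l1 * (e1 * l1 / 6 + 2 * e2 * l2 / 3)) * y0)
      + (x1 * l1 + e2 * l2) * sin s ^ 2 * l1 * (e1 * l1 + 4 * x2 * l2) / 6 * y0)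

/-- The solution `c` of `Emat *ᵥ c = ![0, 0, d, -(e2 * l2 ^ 2 / 2) * y0]`. -/
noncomputable def dragCol (l1 l2 x1 x2 e1 e2 d y0 s : ℝ) : Fin 4 → ℝ :=
  ![sin s * dragColFst l1 l2 x1 x2 e1 e2 d y0 s,
    y0 - l2 / 6 * dragColAngle l1 l2 x1 x2 e1 e2 d y0 s,
    dragColAngle l1 l2 x1 x2 e1 e2 d y0 s,
    2 / (e1 * l1 ^ 2) * (-(e1 * l1 + x2 * l2) * sin s
          * (sin s * dragColFst l1 l2 x1 x2 e1 e2 d y0 s)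
        + (e1 * l1 + e2 * l2) * cos s * (y0 - l2 / 6 * dragColAngle l1 l2 x1 x2 e1 e2 d y0 s)
        - e1 * l1 * (l1 + l2 * cos s) / 2 * dragColAngle l1 l2 x1 x2 e1 e2 d y0 s)]

lemma detFactor_pos (hl1 : 0 < l1) (hl2 : 0 < l2) (hx1 : 0 < x1) (hx2 : 0 < x2)
    (he1 : 0 < e1) (he2 : 0 < e2) (s : ℝ) : 0 < detFactor l1 l2 x1 x2 e1 e2 s := by
  have hs := sin_sq_add_cos_sq s
  rcases eq_or_ne (cos s) 0 with h | h
  · have : sin s ^ 2 = 1 := by simpa [h] using hs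
    rw [detFactor, this, h]
    positivity
  · have : 0 < cos s ^ 2 := by positivity
    rw [detFactor]
    positivity

lemma det_Emat (s : ℝ) :
    (Emat l1 l2 x1 x2 e1 e2 s).det =
      -(e1 * l1 ^ 3 * e2 * l2 ^ 3 / 144) * detFactor l1 l2 x1 x2 e1 e2 s := by
  rw [Emat, detFactor]
  simp [Matrix.det_succ_row_zero, Fin.sum_univ_succ, Fin.succAbove]
  ring

lemma Emat_mulVec_dragCol (hl1 : l1 ≠ 0) (hl2 : l2 ≠ 0) (he1 : e1 ≠ 0) {s : ℝ}
    (hD : detFactor l1 l2 x1 x2 e1 e2 s ≠ 0) (d y0 : ℝ) :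
    (Emat l1 l2 x1 x2 e1 e2 s).mulVec (dragCol l1 l2 x1 x2 e1 e2 d y0 s) =
      ![0, 0, d, -(e2 * l2 ^ 2 / 2) * y0] := by
  have hDeq : detFactor l1 l2 x1 x2 e1 e2 s = _ := rfl
  conv_rhs at hDeq => rw [detFactor]
  ext i
  fin_cases i <;>
    simp only [Emat, dragCol, dragColFst, dragColAngle, Matrix.mulVec, dotProduct,
      Fin.sum_univ_four] <;>
    simp
  all_goals
    field_simp
    try rw [hDeq]
    ring

lemma inv_Emat_col {s : ℝ} {c : Fin 4 → ℝ} {j : Fin 4}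
    (hdet : (Emat l1 l2 x1 x2 e1 e2 s).det ≠ 0)
    (hc : (Emat l1 l2 x1 x2 e1 e2 s).mulVec c = Pi.single j 1) :
    (fun i => (Emat l1 l2 x1 x2 e1 e2 s)⁻¹ i j) = c := by
  have h : (Emat l1 l2 x1 x2 e1 e2 s)⁻¹.mulVec (Pi.single j 1) = c := by
    rw [← hc, Matrix.mulVec_mulVec, Matrix.nonsing_inv_mul _ hdet.isUnit, Matrix.one_mulVec]
  rw [← h, Matrix.mulVec_single_one]
  rfl

lemma contDiff_dragColFst (hl1 : l1 ≠ 0) (hl2 : l2 ≠ 0)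
    (hD : ∀ s, detFactor l1 l2 x1 x2 e1 e2 s ≠ 0) (d y0 : ℝ) :
    ContDiff ℝ ∞ (dragColFst l1 l2 x1 x2 e1 e2 d y0) := by
  have h : ∀ s, l1 * l2 * detFactor l1 l2 x1 x2 e1 e2 s ≠ 0 := fun s =>
    mul_ne_zero (mul_ne_zero hl1 hl2) (hD s)
  unfold dragColFst
  unfold detFactor at h ⊢
  fun_prop (disch := exact h _)

lemma contDiff_dragColAngle (hl1 : l1 ≠ 0) (hl2 : l2 ≠ 0)
    (hD : ∀ s, detFactor l1 l2 x1 x2 e1 e2 s ≠ 0) (d y0 : ℝ) :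
    ContDiff ℝ ∞ (dragColAngle l1 l2 x1 x2 e1 e2 d y0) := by
  have h : ∀ s, l1 * l2 * detFactor l1 l2 x1 x2 e1 e2 s ≠ 0 := fun s =>
    mul_ne_zero (mul_ne_zero hl1 hl2) (hD s)
  unfold dragColAngle
  unfold detFactor at h ⊢
  fun_prop (disch := exact h _)

lemma contDiff_dragCol (hl1 : l1 ≠ 0) (hl2 : l2 ≠ 0)
    (hD : ∀ s, detFactor l1 l2 x1 x2 e1 e2 s ≠ 0) (d y0 : ℝ) :
    ContDiff ℝ ∞ (dragCol l1 l2 x1 x2 e1 e2 d y0) := by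
  have h1 := contDiff_dragColFst hl1 hl2 hD d y0
  have h2 := contDiff_dragColAngle hl1 hl2 hD d y0
  rw [contDiff_pi]
  intro i
  fin_cases i <;> simp only [dragCol] <;> simp <;> fun_prop

lemma dragCol_neg (d y0 s : ℝ) {i : Fin 4} (hi : i ≠ 0) :
    dragCol l1 l2 x1 x2 e1 e2 d y0 (-s) i = dragCol l1 l2 x1 x2 e1 e2 d y0 s i := by
  fin_cases i <;> simp_all [dragCol, dragColFst, dragColAngle, detFactor]

lemma deriv_dragCol_zero_fst (hl1 : l1 ≠ 0) (hl2 : l2 ≠ 0)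
    (hD : ∀ s, detFactor l1 l2 x1 x2 e1 e2 s ≠ 0) (d y0 : ℝ) :
    deriv (dragCol l1 l2 x1 x2 e1 e2 d y0) 0 0 = dragColFst l1 l2 x1 x2 e1 e2 d y0 0 := by
  rw [deriv_pi fun i =>
    (contDiff_pi.1 (contDiff_dragCol hl1 hl2 hD d y0) i).differentiable (by simp) 0]
  refine HasDerivAt.deriv ?_
  refine ((hasDerivAt_sin 0).mul
    ((contDiff_dragColFst hl1 hl2 hD d y0).differentiable (by simp) 0).hasDerivAt).congr_deriv ?_
  simp

lemma deriv_dragCol_zero_of_ne (hl1 : l1 ≠ 0) (hl2 : l2 ≠ 0)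
    (hD : ∀ s, detFactor l1 l2 x1 x2 e1 e2 s ≠ 0) (d y0 : ℝ) {i : Fin 4} (hi : i ≠ 0) :
    deriv (dragCol l1 l2 x1 x2 e1 e2 d y0) 0 i = 0 := by
  rw [deriv_pi fun i =>
    (contDiff_pi.1 (contDiff_dragCol hl1 hl2 hD d y0) i).differentiable (by simp) 0]
  exact deriv_zero_of_even fun s => dragCol_neg d y0 s hi

end Columns

/-- LARC at the origin. -/
theorem stmt_10 (l1 l2 x1 x2 e1 e2 k M1 M2 : ℝ)
    (hl1 : 0 < l1) (hl2 : 0 < l2) (hx1 : 0 < x1) (hx2 : 0 < x2)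
    (he1 : 0 < e1) (he2 : 0 < e2) (hk : 0 < k)
    (hA : AssumptionA l1 l2 x1 x2 e1 e2 M1 M2) :
    let G0 := F0 l1 l2 x1 x2 e1 e2 k
    let G1 := F1 l1 l2 x1 x2 e1 e2 M1
    let G2 := F2 l1 l2 x1 x2 e1 e2 M1 M2
    Submodule.span ℝ
      ({lieBr G0 G2 Ovec,
        lieBr G1 G2 Ovec,
        lieBr G2 (lieBr G1 G2) Ovec,
        lieBr G1 (lieBr G2 (lieBr G2 (lieBr G1 G2))) Ovec
          - lieBr G2 (lieBr G1 (lieBr G2 (lieBr G1 G2))) Ovec,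
        lieBr G0 (lieBr G2 (lieBr G2 (lieBr G1 G2))) Ovec
          - lieBr G2 (lieBr G0 (lieBr G2 (lieBr G1 G2))) Ovec} :
        Set (Fin 4 → ℝ)) = ⊤ := by
  intro G0 G1 G2
  obtain ⟨hne, hxe1, hxe2, hM1, hM2, hM⟩ := hA
  have hD := fun s => (detFactor_pos hl1 hl2 hx1 hx2 he1 he2 s).ne'
  have hdet : ∀ s, (Emat l1 l2 x1 x2 e1 e2 s).det ≠ 0 := fun s => by
    rw [det_Emat]
    exact mul_ne_zero (neg_ne_zero.2 (by positivity)) (hD s)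
  set y0 : ℝ := -2 / (e2 * l2 ^ 2) with hy0
  set a := dragCol l1 l2 x1 x2 e1 e2 1 0 with ha
  set b := dragCol l1 l2 x1 x2 e1 e2 0 y0 with hb
  have hcol3 : ∀ s, (fun i => (Emat l1 l2 x1 x2 e1 e2 s)⁻¹ i 2) = a s := fun s => by
    refine inv_Emat_col (hdet s) ?_
    rw [ha, Emat_mulVec_dragCol hl1.ne' hl2.ne' he1.ne' (hD s)]
    ext i
    fin_cases i <;> simp
  have hcol4 : ∀ s, (fun i => (Emat l1 l2 x1 x2 e1 e2 s)⁻¹ i 3) = b s := fun s => by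
    refine inv_Emat_col (hdet s) ?_
    rw [hb, Emat_mulVec_dragCol hl1.ne' hl2.ne' he1.ne' (hD s)]
    ext i
    fin_cases i <;> simp [hy0]
    field_simp
  have hG0 : G0 = rotLift fun s => (k * s) • b s := by
    ext1 z
    simp only [G0, F0, X4, hcol4, rotLift, Matrix.mulVec_smul]
  have hG1 : G1 = rotLift fun s => (M1 * sin s) • a s := by
    ext1 z
    simp only [G1, F1, X3, hcol3, rotLift, Matrix.mulVec_smul]
  have hG2 : G2 = rotLift fun s => (-(M1 * cos s + M2)) • a s - M2 • b s := by
    ext1 z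
    simp only [G2, F2, X3, X4, hcol3, hcol4, rotLift, Matrix.mulVec_smul, Matrix.mulVec_sub]
  have haniso : 0 < e1 * l1 ^ 2 * (e2 - x2) * l2 + e2 * l2 ^ 2 * (e1 - x1) * l1 := by
    have h1 : 0 ≤ e1 - x1 := sub_nonneg.2 hxe1
    have h2 : 0 ≤ e2 - x2 := sub_nonneg.2 hxe2
    rcases h1.lt_or_eq with h | h
    · positivity
    · have h2' : 0 < e2 - x2 := h2.lt_of_ne' fun h' => hne (by rw [← h, h'])
      positivity
  have hΔ : a 0 2 * b 0 3 - a 0 3 * b 0 2 =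
      -36 / (l1 * l2 * (e1 * l1 ^ 2) * (e2 * l2 ^ 2)) := by
    simp [ha, hb, hy0, dragCol, dragColAngle, detFactor]
    field_simp
    ring
  have hq : curveBr a b 0 0 = -18 / (l1 * l2 * (e1 * l1 + e2 * l2) * (e2 * l2 ^ 2)) *
      ((e1 * l1 ^ 2 * (e2 - x2) * l2 + e2 * l2 ^ 2 * (e1 - x1) * l1)
        / (e1 * l1 ^ 2 * (x1 * l1 + x2 * l2))) := by
    rw [curveBr_apply, ha, hb, deriv_dragCol_zero_fst hl1.ne' hl2.ne' hD,
      deriv_dragCol_zero_fst hl1.ne' hl2.ne' hD]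
    simp [hy0, quarterTurn, dragCol, dragColFst, dragColAngle, detFactor]
    field_simp
    ring
  have hg : (M1 + M2) * a 0 3 + M2 * b 0 3 = -3 / (l1 * l2 * (e1 * l1 + e2 * l2)) *
      ((3 + 4*(l2/l1) + e2*l2^2/(e1*l1^2)) * M1
        - (3 + 4*(l1/l2) + e1*l1^2/(e2*l2^2)) * M2) := by
    simp [ha, hb, hy0, dragCol, dragColAngle, detFactor]
    field_simp
    ring
  refine span_brackets_eq_top (contDiff_dragCol hl1.ne' hl2.ne' hD 1 0)
    (contDiff_dragCol hl1.ne' hl2.ne' hD 0 y0) (by simp [dragCol]) (by simp [dragCol])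
    (fun i hi => deriv_dragCol_zero_of_ne hl1.ne' hl2.ne' hD 1 0 hi)
    (fun i hi => deriv_dragCol_zero_of_ne hl1.ne' hl2.ne' hD 0 y0 hi)
    (hΔ.trans_ne ?_) (hq.trans_ne ?_) hk.ne' hM1 hM2 (hg.trans_ne ?_) hG0 hG1 hG2
  · exact div_ne_zero (by norm_num) (by positivity)
  · exact mul_ne_zero (div_ne_zero (by norm_num) (by positivity))
      (div_ne_zero haniso.ne' (by positivity))
  · exact mul_ne_zero (div_ne_zero (by norm_num) (by positivity)) hM
end
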